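/- arXiv:1904.08882 — 3 statements merged into one kernel-verified Lean document; each statement's English description precedes it below -/
import Mathlib

section
/- Let τ ∈ ℕ and let X = (X_n)_{n∈ℕ₀} be a discrete-time stochastic process that is marginally self-similar with scaling function b : ℕ → (0,∞) and has marginally cyclostationary increments with period τ, and assume P(X₁ = 0) < 1. Then exactly one of the following holds: (1) b(n) = 1 for all n ∈ ℕ; (2) there exist a prime p and a real H > 0 such that b(n) = (|n|_p)^H for all n ∈ ℕ (and such p is unique); (3) there exists a real H > 0 such that b(n) = n^H for all n ∈ ℕ. -/
open MeasureTheory ProbabilityTheory Filter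

noncomputable section

/-- The `p`-adic norm of a natural number, as a real number (`0` for `n = 0`). -/
def padicNormNat (p n : ℕ) : ℝ := ((padicNorm p (n : ℚ) : ℚ) : ℝ)

/-- Equality in distribution of two families of random variables: the laws of the
induced maps into the product space coincide. -/
def EqDistFam {ι Ω₁ Ω₂ E : Type*} [MeasurableSpace Ω₁] [MeasurableSpace Ω₂]
    [MeasurableSpace E]
    (P₁ : Measure Ω₁) (P₂ : Measure Ω₂) (X : ι → Ω₁ → E) (Y : ι → Ω₂ → E) : Prop :=
  Measure.map (fun ω i => X i ω) P₁ = Measure.map (fun ω i => Y i ω) P₂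

/-- A discrete-time process is self-similar with scaling function `b` if for every `n ≥ 1`,
`(X (n*m))ₘ ≐ (b n • X m)ₘ`. -/
def SelfSimilar {Ω : Type*} [MeasurableSpace Ω] (P : Measure Ω) (X : ℕ → Ω → ℝ)
    (b : ℕ → ℝ) : Prop :=
  ∀ n : ℕ, 1 ≤ n → EqDistFam P P (fun m ω => X (n * m) ω) (fun m ω => b n * X m ω)

/-- A discrete-time process has stationary increments if for every `k ≥ 1`,
`(X (m+1) - X m)ₘ ≐ (X (m+k+1) - X (m+k))ₘ`. -/
def StationaryIncrements {Ω : Type*} [MeasurableSpace Ω] (P : Measure Ω)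
    (X : ℕ → Ω → ℝ) : Prop :=
  ∀ k : ℕ, 1 ≤ k → EqDistFam P P (fun m ω => X (m + 1) ω - X m ω)
    (fun m ω => X (m + k + 1) ω - X (m + k) ω)

/-- Type I scaling function: identically one. -/
def IsTypeI (b : ℕ → ℝ) : Prop := ∀ n : ℕ, 1 ≤ n → b n = 1

/-- Type II scaling function: `b n = (|n|_p)^H` for a prime `p` and some `H > 0`. -/
def IsTypeII (p : ℕ) (b : ℕ → ℝ) : Prop :=
  p.Prime ∧ ∃ H : ℝ, 0 < H ∧ ∀ n : ℕ, 1 ≤ n → b n = (padicNormNat p n) ^ H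

/-- Type III scaling function: `b n = n^H` for some `H > 0`. -/
def IsTypeIII (b : ℕ → ℝ) : Prop :=
  ∃ H : ℝ, 0 < H ∧ ∀ n : ℕ, 1 ≤ n → b n = (n : ℝ) ^ H

lemma aux_interval (f : ℕ → ℝ) (hmul : ∀ m n, 1 ≤ m → 1 ≤ n → f (m * n) = f m + f n)
    (r : ℕ) (hr : 2 ≤ r) (ε K : ℝ) (hε : 0 < ε) (hεr : ε ≤ f r)
    (hK : ∀ n, 1 ≤ n → K ≤ f n → |f (n + 1) - f n| ≤ ε / r)
    (m : ℕ) (hm : 1 ≤ m) (hfm : K ≤ f m) :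
    ∀ k n : ℕ, r ^ k * m ≤ n → n < r ^ k * (m + 1) → |f n - f m - k * f r| ≤ k * ε := by
  have hr0 : (0 : ℝ) < r := by positivity
  have step : ∀ m, 1 ≤ m → K ≤ f m → ∀ j : ℕ, j < r → |f (r * m + j) - f r - f m| ≤ j * (ε / r) := by
    intro m hm hfm j
    induction j with
    | zero => intro _; simp [hmul r m (by omega) hm]
    | succ j ih =>
      intro hj
      have h1 := ih (by omega)
      have h2 : (j : ℝ) * (ε / r) ≤ ε := by
        have : (j : ℝ) ≤ r := by exact_mod_cast (by omega : j ≤ r)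
        calc (j : ℝ) * (ε / r) ≤ r * (ε / r) := by gcongr
          _ = ε := by field_simp
      have h3 := abs_le.1 h1
      have hrm : 1 ≤ r * m + j := by nlinarith
      have h4 := hK (r * m + j) hrm (by linarith)
      have h5 := abs_le.1 h4
      rw [← add_assoc]
      push_cast
      rw [abs_le]
      constructor <;> linarith
  intro k
  induction k with
  | zero =>
    intro n h1 h2
    have : n = m := by simp at h1 h2; omega
    simp [this]
  | succ k ih =>
    intro n h1 h2
    have hrp : 0 < r := by omega
    have e1 : r ^ k * m ≤ n / r := by
      rw [Nat.le_div_iff_mul_le hrp]; rw [pow_succ] at h1; linarith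
    have e2 : n / r < r ^ k * (m + 1) := by
      rw [Nat.div_lt_iff_lt_mul hrp]; rw [pow_succ] at h2; linarith
    have h3 := ih (n / r) e1 e2
    have hpos : 1 ≤ n / r := le_trans (Nat.mul_pos (pow_pos hrp k) hm) e1
    have h4 := abs_le.1 h3
    have hk0 : (0 : ℝ) ≤ k := by positivity
    have h5 : K ≤ f (n / r) := by nlinarith
    have h6 := step (n / r) hpos h5 (n % r) (Nat.mod_lt _ hrp)
    rw [Nat.div_add_mod] at h6
    have h2 : ((n % r : ℕ) : ℝ) * (ε / r) ≤ ε := by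
      have : ((n % r : ℕ) : ℝ) ≤ r := by exact_mod_cast (Nat.mod_lt _ hrp).le
      calc ((n % r : ℕ) : ℝ) * (ε / r) ≤ r * (ε / r) := by gcongr
        _ = ε := by field_simp
    have h7 := abs_le.1 h6
    push_cast
    rw [abs_le]
    constructor <;> linarith

lemma aux_log (f : ℕ → ℝ) (hmul : ∀ m n, 1 ≤ m → 1 ≤ n → f (m * n) = f m + f n)
    (r : ℕ) (hr : 2 ≤ r) (hfr : 0 < f r)
    (H : ∀ ε : ℝ, 0 < ε → ∃ K : ℝ, ∀ n, 1 ≤ n → K ≤ f n → |f (n + 1) - f n| ≤ ε)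
    (s : ℕ) (hs : 2 ≤ s) : f s = f r / Real.log r * Real.log s := by
  have hlr : 0 < Real.log r := Real.log_pos (by exact_mod_cast hr)
  have hls : 0 < Real.log s := Real.log_pos (by exact_mod_cast hs)
  have hpow : ∀ t, 1 ≤ t → ∀ e : ℕ, f (t ^ e) = e * f t := by
    intro t ht e
    have h1 : f 1 = 0 := by have := hmul 1 1 le_rfl le_rfl; simp at this; exact this
    induction e with
    | zero => simp [h1]
    | succ e ih =>
      rw [pow_succ, hmul _ _ (Nat.pos_of_ne_zero (by positivity)) ht, ih]; push_cast; ring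
  set L := Real.log r / Real.log s with hL
  have key : ∀ ε : ℝ, 0 < ε → ε ≤ f r → |L * f s - f r| ≤ ε := by
    intro ε hε hεr
    have hr0 : (0 : ℝ) < r := by positivity
    obtain ⟨K, hK⟩ := H (ε / r) (by positivity)
    obtain ⟨a, ha⟩ := exists_nat_ge (K / f r)
    set m := r ^ a with hmdef
    have hm : 1 ≤ m := Nat.one_le_pow _ _ (by omega)
    have hfm : K ≤ f m := by
      rw [hmdef, hpow r (by omega)]
      rwa [div_le_iff₀ hfr] at ha
    have hint := aux_interval f hmul r hr ε K hε hεr hK m hm hfm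
    set B := ∑ q ∈ Finset.range (s * m + 2), |f q| with hB
    have main : ∀ k : ℕ, (k : ℝ) * |L * f s - f r| ≤ k * ε + (B + |f m| + |f s|) := by
      intro k
      set e := Nat.log s (r ^ k) with he
      have hrk : r ^ k ≠ 0 := by positivity
      have e1 : s ^ e ≤ r ^ k := Nat.pow_log_le_self s hrk
      have e2 : r ^ k < s ^ (e + 1) := Nat.lt_pow_succ_log_self (by omega) _
      have hse : 0 < s ^ e := by positivity
      set q := (r ^ k * m + s ^ e - 1) / s ^ e with hq
      have hrm : 1 ≤ r ^ k * m := Nat.mul_pos (Nat.pos_of_ne_zero hrk) hm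
      have q1 : r ^ k * m ≤ s ^ e * q := by
        have := Nat.lt_mul_div_succ (r ^ k * m + s ^ e - 1) hse
        rw [← hq, mul_add] at this
        omega
      have q2 : s ^ e * q < r ^ k * m + s ^ e := by
        have := Nat.mul_div_le (r ^ k * m + s ^ e - 1) (s ^ e)
        rw [← hq] at this; omega
      have q3 : s ^ e * q < r ^ k * (m + 1) := by rw [mul_add]; omega
      have q4 : q < s * m + 2 := by
        have : s ^ e * q < s ^ e * (s * m + 1) := by
          calc s ^ e * q < r ^ k * m + s ^ e := q2
            _ ≤ s ^ (e + 1) * m + s ^ e := by gcongr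
            _ = s ^ e * (s * m + 1) := by ring
        have := Nat.lt_of_mul_lt_mul_left this
        omega
      have q5 : 1 ≤ q := by
        rcases Nat.eq_zero_or_pos q with h | h
        · rw [h] at q1; omega
        · exact h
      have h1 := hint k (s ^ e * q) q1 q3
      rw [hmul _ _ hse q5, hpow s (by omega)] at h1
      have hfq : |f q| ≤ B :=
        Finset.single_le_sum (f := fun q => |f q|) (fun _ _ => abs_nonneg _) (Finset.mem_range.2 q4)
      have g1 : (e : ℝ) * Real.log s ≤ k * Real.log r := by
        rw [← Real.log_pow, ← Real.log_pow]
        apply Real.log_le_log (by positivity); exact_mod_cast e1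
      have g2 : (k : ℝ) * Real.log r ≤ (e + 1) * Real.log s := by
        have : (k : ℝ) * Real.log r ≤ ((e + 1 : ℕ) : ℝ) * Real.log s := by
          rw [← Real.log_pow, ← Real.log_pow]
          apply Real.log_le_log (by positivity); exact_mod_cast e2.le
        push_cast at this; exact this
      have g3 : (e : ℝ) ≤ k * L := by rw [hL, mul_div_assoc', le_div_iff₀ hls]; exact g1
      have g4 : k * L ≤ (e : ℝ) + 1 := by rw [hL, mul_div_assoc', div_le_iff₀ hls]; exact g2
      have g5 : |(k * L - e) * f s| ≤ |f s| := by
        rw [abs_mul]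
        have : |k * L - e| ≤ 1 := by rw [abs_le]; constructor <;> linarith
        nlinarith [abs_nonneg (f s)]
      have hk0 : (0 : ℝ) ≤ k := by positivity
      rw [← abs_of_nonneg hk0, ← abs_mul, abs_of_nonneg hk0]
      have h1' := abs_le.1 h1
      have a1 := abs_le.1 hfq
      have a2 := abs_le.1 g5
      have a3 := neg_abs_le (f m)
      have a4 := le_abs_self (f m)
      rw [abs_le]
      constructor <;> nlinarith
    by_contra hcon
    push Not at hcon
    obtain ⟨k, hk⟩ := exists_nat_gt ((B + |f m| + |f s|) / (|L * f s - f r| - ε))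
    rw [div_lt_iff₀ (by linarith)] at hk
    have := main k
    linarith
  have h0 : |L * f s - f r| ≤ 0 := by
    apply le_of_forall_pos_le_add
    intro ε hε
    have := key (min ε (f r)) (lt_min hε hfr) (min_le_right _ _)
    have := min_le_left ε (f r)
    linarith
  have h1 : L * f s = f r := by
    have := abs_nonpos_iff.1 h0
    linarith
  rw [← h1, hL]
  field_simp

lemma crt3 (p q a c t K n : ℕ) (hp : p.Prime) (hq : q.Prime) (hpq : p ≠ q)
    (hpt : p.Coprime t) (hqt : q.Coprime t) (hpn : p ^ a ∣ n) (hqn : q ^ c ∣ n + 1) :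
    ∃ x, p ^ K ∣ x ∧ q ^ K ∣ x + 1 ∧ x ≡ n [MOD (p ^ a * q ^ c * t)] := by
  have hcop : Nat.Coprime p q := (Nat.coprime_primes hp hq).2 hpq
  set P := p ^ (K + a) with hP
  set Q := q ^ (K + c) with hQ
  have hPQ : P.Coprime Q := Nat.Coprime.pow _ _ hcop
  have hPt : P.Coprime t := Nat.Coprime.pow_left _ hpt
  have hQt : Q.Coprime t := Nat.Coprime.pow_left _ hqt
  have hQpos : 0 < Q := pow_pos hq.pos _
  obtain ⟨y, hy1, hy2⟩ := Nat.chineseRemainder hPQ 0 (Q - 1)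
  obtain ⟨x, hx1, hx2⟩ := Nat.chineseRemainder (Nat.Coprime.mul_left hPt hQt) y n
  have hxP : P ∣ x := (Nat.modEq_zero_iff_dvd).1 ((hx1.of_mul_right Q).trans hy1)
  have hxQ : Q ∣ x + 1 := by
    have h := ((hx1.of_mul_left P).trans hy2).add_right 1
    rw [Nat.sub_add_cancel hQpos] at h
    exact (Nat.modEq_zero_iff_dvd).1 (h.trans (by simp [Nat.ModEq]))
  refine ⟨x, (pow_dvd_pow p (by omega)).trans hxP, (pow_dvd_pow q (by omega)).trans hxQ, ?_⟩
  have hc1 : (p ^ a).Coprime (q ^ c) := Nat.Coprime.pow _ _ hcop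
  have hc2 : (p ^ a * q ^ c).Coprime t :=
    Nat.Coprime.mul_left (Nat.Coprime.pow_left _ hpt) (Nat.Coprime.pow_left _ hqt)
  rw [← Nat.modEq_and_modEq_iff_modEq_mul hc2, ← Nat.modEq_and_modEq_iff_modEq_mul hc1]
  refine ⟨⟨?_, ?_⟩, hx2⟩
  · exact ((Nat.modEq_zero_iff_dvd).2 ((pow_dvd_pow p (by omega)).trans hxP)).trans
      ((Nat.modEq_zero_iff_dvd).2 hpn).symm
  · apply Nat.ModEq.add_right_cancel' 1
    exact ((Nat.modEq_zero_iff_dvd).2 ((pow_dvd_pow q (by omega)).trans hxQ)).trans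
      ((Nat.modEq_zero_iff_dvd).2 hqn).symm

lemma exists_prime_ne_one (b : ℕ → ℝ) (hb1 : b 1 = 1)
    (hmul : ∀ m n, 1 ≤ m → 1 ≤ n → b (m * n) = b m * b n) :
    ∀ w, 1 ≤ w → b w ≠ 1 → ∃ r, r.Prime ∧ r ∣ w ∧ b r ≠ 1 := by
  intro w
  induction w using Nat.strong_induction_on with
  | _ w ih =>
    intro hw hbw
    by_cases h1 : w = 1
    · exact absurd (h1 ▸ hb1) hbw
    have hr := Nat.minFac_prime h1
    obtain ⟨v, hv⟩ := Nat.minFac_dvd w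
    by_cases hbr : b w.minFac = 1
    · have hv1 : 1 ≤ v := by
        rcases Nat.eq_zero_or_pos v with h | h
        · rw [h] at hv; omega
        · exact h
      have hvw : v < w := by
        have := hr.two_le
        rw [hv] at this ⊢
        nlinarith [hr.two_le]
      have hbv : b v ≠ 1 := by
        intro h
        apply hbw
        rw [hv, hmul _ _ hr.pos hv1, hbr, h, one_mul]
      obtain ⟨r, h1, h2, h3⟩ := ih v hvw hv1 hbv
      exact ⟨r, h1, h2.trans (Dvd.intro_left _ hv.symm), h3⟩
    · exact ⟨_, hr, Nat.minFac_dvd w, hbr⟩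

/-- abstract argument producing a new prime with `b r < 1` -/
lemma new_prime (b : ℕ → ℝ) (hbpos : ∀ n : ℕ, 1 ≤ n → 0 < b n) (hb1 : b 1 = 1)
    (hmul : ∀ m n, 1 ≤ m → 1 ≤ n → b (m * n) = b m * b n)
    (hle : ∀ n : ℕ, 1 ≤ n → b n ≤ 1) (τ : ℕ) (hτ : 1 ≤ τ)
    (p q : ℕ) (hp : p.Prime) (hq : q.Prime) (hpq : p ≠ q) (hbp : b p < 1)
    (Z : ∀ a c t n, τ = p ^ a * q ^ c * t → p.Coprime t → q.Coprime t → p ^ a ∣ n → q ^ c ∣ n + 1 →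
      1 ≤ n → b n = b (n + 1)) (N : ℕ) (hN : 1 ≤ N) :
    ∃ r, r.Prime ∧ r.Coprime N ∧ b r < 1 := by
  have hcop : Nat.Coprime p q := (Nat.coprime_primes hp hq).2 hpq
  have hpow : ∀ t, 1 ≤ t → ∀ e : ℕ, b (t ^ e) = b t ^ e := by
    intro t ht e
    induction e with
    | zero => simp [hb1]
    | succ e ih => rw [pow_succ, hmul _ _ (Nat.one_le_pow _ _ ht) ht, ih, pow_succ]
  obtain ⟨a, τ1, hpτ1, hτ1⟩ := Nat.exists_eq_pow_mul_and_not_dvd (n := τ) (by omega) p hp.ne_one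
  have hτ10 : τ1 ≠ 0 := by rintro rfl; simp at hpτ1
  obtain ⟨c, t, hqt, ht⟩ := Nat.exists_eq_pow_mul_and_not_dvd (n := τ1) hτ10 q hq.ne_one
  obtain ⟨d, N', hqN', hN'⟩ := Nat.exists_eq_pow_mul_and_not_dvd (n := N) (by omega) q hq.ne_one
  have hNpos : 1 ≤ N' := by
    rcases Nat.eq_zero_or_pos N' with h | h
    · simp [h] at hqN'
    · exact h
  have hpt : ¬ p ∣ t := fun h => hpτ1 (ht ▸ Dvd.dvd.mul_left h _)
  obtain ⟨K, hK⟩ := exists_pow_lt_of_lt_one (pow_pos (hbpos q hq.pos) c) hbp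
  set E := p ^ (K + a) * N' with hE
  have hqE : q.Coprime E := Nat.Coprime.mul_right (Nat.Coprime.pow_right _ hcop.symm)
    ((Nat.Prime.coprime_iff_not_dvd hq).2 hqN')
  have hE0 : 1 ≤ E := Nat.mul_pos (pow_pos hp.pos _) hNpos
  have hEQ : E.Coprime (q ^ (c + 1)) := Nat.Coprime.pow_right _ hqE.symm
  have hqc : 0 < q ^ c := pow_pos hq.pos _
  obtain ⟨x, hx1, hx2⟩ := Nat.chineseRemainder hEQ 0 (q ^ c - 1)
  set n := x + E * q ^ (c + 1) with hn
  have hEn : E ∣ n := dvd_add ((Nat.modEq_zero_iff_dvd).1 hx1) (Dvd.intro _ rfl)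
  have hn1 : 1 ≤ n := by
    have : 0 < E * q ^ (c + 1) := Nat.mul_pos hE0 (pow_pos hq.pos _)
    omega
  have hnq : n + 1 ≡ q ^ c [MOD q ^ (c + 1)] := by
    have h : x + 1 ≡ q ^ c [MOD q ^ (c + 1)] := by
      have := hx2.add_right 1
      rwa [Nat.sub_add_cancel hqc] at this
    have h2 : n + 1 = (x + 1) + E * q ^ (c + 1) := by rw [hn]; ring
    rw [h2]
    exact (by simp [Nat.ModEq] : (x + 1) + E * q ^ (c + 1) ≡ x + 1 [MOD q ^ (c + 1)]).trans h
  obtain ⟨w, hw⟩ : q ^ c ∣ n + 1 :=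
    (hnq.dvd_iff (pow_dvd_pow q (by omega))).2 dvd_rfl
  have hqw : q.Coprime w := by
    rw [Nat.Prime.coprime_iff_not_dvd hq]
    rintro ⟨v, rfl⟩
    have h3 : q ^ (c + 1) ∣ n + 1 := ⟨v, by rw [hw]; ring⟩
    have h4 : q ^ (c + 1) ∣ q ^ c := (hnq.dvd_iff dvd_rfl).1 h3
    have h5 := (Nat.pow_dvd_pow_iff_le_right hq.one_lt).1 h4
    omega
  have hw1 : 1 ≤ w := by
    rcases Nat.eq_zero_or_pos w with h | h
    · rw [h] at hw; omega
    · exact h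
  have hwE : Nat.Coprime E w := by
    have h6 : Nat.Coprime n (n + 1) := by simp
    exact (h6.coprime_dvd_left hEn).coprime_dvd_right (Dvd.intro_left _ hw.symm)
  have hbn : b n ≤ b p ^ K := by
    obtain ⟨v, hv⟩ : p ^ K ∣ n :=
      ((pow_dvd_pow p (by omega)).trans (Dvd.intro _ hE.symm)).trans hEn
    have hv1 : 1 ≤ v := by
      rcases Nat.eq_zero_or_pos v with h | h
      · rw [h] at hv; omega
      · exact h
    rw [hv, hmul _ _ (pow_pos hp.pos _) hv1, hpow p hp.pos]
    exact mul_le_of_le_one_right (pow_pos (hbpos p hp.pos) K).le (hle v hv1)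
  have hbeq : b n = b (n + 1) := by
    refine Z a c t n (by rw [hτ1, ht]; ring) ((Nat.Prime.coprime_iff_not_dvd hp).2 hpt)
      ((Nat.Prime.coprime_iff_not_dvd hq).2 hqt) ?_ (Dvd.intro _ hw.symm) hn1
    exact ((pow_dvd_pow p (by omega)).trans (Dvd.intro _ hE.symm)).trans hEn
  have hbw : b w ≠ 1 := by
    intro h
    rw [hw, hmul _ _ hqc hw1, hpow q hq.pos, h, mul_one] at hbeq
    linarith
  obtain ⟨r, hr, hrw, hbr⟩ := exists_prime_ne_one b hb1 hmul w hw1 hbw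
  refine ⟨r, hr, ?_, lt_of_le_of_ne (hle r hr.pos) hbr⟩
  rw [hN']
  refine Nat.Coprime.mul_right (Nat.Coprime.pow_right _ (hqw.symm.coprime_dvd_left hrw)) ?_
  exact (hwE.symm.coprime_dvd_left hrw).coprime_dvd_right (Dvd.intro_left _ hE.symm)

section prob
variable {Ω : Type*} [MeasurableSpace Ω] (P : Measure Ω) [IsProbabilityMeasure P]

lemma tail_small (Y : Ω → ℝ) (hY : Measurable Y) (η : ℝ) (hη : 0 < η) :
    ∃ R : ℝ, 0 < R ∧ ∀ t, R ≤ t → P.real {ω | t ≤ |Y ω|} ≤ η := by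
  have h1 : Tendsto (fun n : ℕ => P {ω | (n : ℝ) ≤ |Y ω|}) atTop
      (nhds (P (⋂ n : ℕ, {ω | (n : ℝ) ≤ |Y ω|}))) := by
    apply tendsto_measure_iInter_atTop
    · intro n; exact (measurableSet_le measurable_const hY.abs).nullMeasurableSet
    · intro m n hmn ω hω
      have : (m : ℝ) ≤ n := by exact_mod_cast hmn
      simp only [Set.mem_ofPred_eq] at hω ⊢; linarith
    · exact ⟨0, measure_ne_top _ _⟩
  have h2 : (⋂ n : ℕ, {ω | (n : ℝ) ≤ |Y ω|}) = ∅ := by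
    ext ω
    simp only [Set.mem_iInter, Set.mem_ofPred_eq, Set.mem_empty_iff_false, iff_false, not_forall, not_le]
    exact exists_nat_gt _
  rw [h2, measure_empty] at h1
  have h3 := h1.eventually (gt_mem_nhds (ENNReal.ofReal_pos.2 hη))
  obtain ⟨n, hn, hn1⟩ := (h3.and (eventually_ge_atTop 1)).exists
  refine ⟨n, by exact_mod_cast hn1, fun t ht => ?_⟩
  have h4 : P {ω | t ≤ |Y ω|} ≤ ENNReal.ofReal η :=
    (measure_mono (fun ω (hω : t ≤ |Y ω|) => le_trans ht hω)).trans hn.le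
  exact ENNReal.toReal_le_of_le_ofReal hη.le h4

lemma zero_of_tail (Y : Ω → ℝ) (h : ∀ s : ℝ, 0 < s → P.real {ω | s ≤ |Y ω|} ≤ 0) :
    ∀ᵐ ω ∂P, Y ω = 0 := by
  have h1 : ∀ n : ℕ, ∀ᵐ ω ∂P, ¬ (1 / ((n : ℝ) + 1) ≤ |Y ω|) := by
    intro n
    rw [ae_iff]
    simp only [not_not]
    have := le_antisymm (h (1 / ((n : ℝ) + 1)) (by positivity)) measureReal_nonneg
    rwa [measureReal_eq_zero_iff] at this
  filter_upwards [ae_all_iff.2 h1] with ω hω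
  by_contra hne
  obtain ⟨n, hn⟩ := exists_nat_one_div_lt (abs_pos.2 hne)
  exact hω n hn.le

lemma zero_of_scale (Y : Ω → ℝ) (hY : Measurable Y) (l : ℝ) (hl : 1 < l)
    (h : ∀ s : ℝ, 0 < s → P.real {ω | s ≤ |Y ω|} ≤ P.real {ω | l * s ≤ |Y ω|}) :
    ∀ᵐ ω ∂P, Y ω = 0 := by
  apply zero_of_tail
  intro s hs
  apply le_of_forall_pos_le_add
  intro η hη
  obtain ⟨R, hR, hR'⟩ := tail_small P Y hY η hη
  have hk : ∀ k : ℕ, P.real {ω | s ≤ |Y ω|} ≤ P.real {ω | l ^ k * s ≤ |Y ω|} := by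
    intro k
    induction k with
    | zero => simp
    | succ k ih =>
      refine ih.trans ((h (l ^ k * s) (by positivity)).trans (le_of_eq ?_))
      rw [pow_succ', mul_assoc]
  obtain ⟨k, hk'⟩ := pow_unbounded_of_one_lt (R / s) hl
  rw [div_lt_iff₀ hs] at hk'
  rw [zero_add]
  exact (hk k).trans (hR' _ hk'.le)

lemma real_eq {Y Z : Ω → ℝ} (h : IdentDistrib Y Z P P) (t : ℝ) :
    P.real {ω | t ≤ |Y ω|} = P.real {ω | t ≤ |Z ω|} := by
  have hm : MeasurableSet {x : ℝ | t ≤ |x|} := measurableSet_le measurable_const measurable_id.abs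
  have := h.measure_mem_eq hm
  simp only [Measure.real]
  exact congrArg ENNReal.toReal this

lemma scale_unique_aux (Y : Ω → ℝ) (hY : Measurable Y) (c d : ℝ) (hc : 0 < c) (hcd : c < d)
    (h : IdentDistrib (fun ω => c * Y ω) (fun ω => d * Y ω) P P) :
    ∀ᵐ ω ∂P, Y ω = 0 := by
  have hd : 0 < d := hc.trans hcd
  apply zero_of_scale P Y hY (d / c) (by rwa [one_lt_div hc])
  intro s hs
  have := real_eq P h (d * s)
  have e1 : {ω | d * s ≤ |c * Y ω|} = {ω | d / c * s ≤ |Y ω|} := by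
    ext ω
    simp only [Set.mem_ofPred_eq, abs_mul, abs_of_pos hc]
    rw [div_mul_eq_mul_div, div_le_iff₀ hc, mul_comm c]
  have e2 : {ω | d * s ≤ |d * Y ω|} = {ω | s ≤ |Y ω|} := by
    ext ω
    simp only [Set.mem_ofPred_eq, abs_mul, abs_of_pos hd]
    exact mul_le_mul_iff_right₀ hd
  rw [e1, e2] at this
  exact this.ge

lemma scale_unique (Y : Ω → ℝ) (hY : Measurable Y) (c d : ℝ) (hc : 0 < c) (hd : 0 < d)
    (h : IdentDistrib (fun ω => c * Y ω) (fun ω => d * Y ω) P P)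
    (hne : ¬ ∀ᵐ ω ∂P, Y ω = 0) : c = d := by
  rcases lt_trichotomy c d with h1 | h1 | h1
  · exact absurd (scale_unique_aux P Y hY c d hc h1 h) hne
  · exact h1
  · exact absurd (scale_unique_aux P Y hY d c hd h1 h.symm) hne

lemma union_bound (Y Z W : Ω → ℝ) (s t u : ℝ) (h : ∀ ω, |Y ω| ≤ |Z ω| + |W ω|) (hs : t + u ≤ s) :
    P.real {ω | s ≤ |Y ω|} ≤ P.real {ω | t ≤ |Z ω|} + P.real {ω | u ≤ |W ω|} := by
  refine le_trans (measureReal_mono ?_) (measureReal_union_le _ _)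
  intro ω hω
  simp only [Set.mem_ofPred_eq, Set.mem_union] at hω ⊢
  by_contra hcon
  push Not at hcon
  have := h ω
  linarith [hcon.1, hcon.2]

lemma incr_mod (X : ℕ → Ω → ℝ) (τ : ℕ)
    (hcsi : ∀ k m : ℕ, IdentDistrib (fun ω => X (m + 1) ω - X m ω)
      (fun ω => X (m + k * τ + 1) ω - X (m + k * τ) ω) P P) (m n : ℕ) (h : m ≡ n [MOD τ]) :
    IdentDistrib (fun ω => X (m + 1) ω - X m ω) (fun ω => X (n + 1) ω - X n ω) P P := by
  have key : ∀ m, IdentDistrib (fun ω => X (m % τ + 1) ω - X (m % τ) ω)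
      (fun ω => X (m + 1) ω - X m ω) P P := by
    intro m
    have := hcsi (m / τ) (m % τ)
    rwa [Nat.mod_add_div'] at this
  have h1 := key m
  rw [h] at h1
  exact h1.symm.trans (key n)

lemma incr_tight (X : ℕ → Ω → ℝ) (hX : ∀ n, Measurable (X n)) (τ : ℕ) (hτ : 1 ≤ τ)
    (hcsi : ∀ k m : ℕ, IdentDistrib (fun ω => X (m + 1) ω - X m ω)
      (fun ω => X (m + k * τ + 1) ω - X (m + k * τ) ω) P P) (η : ℝ) (hη : 0 < η) :
    ∃ R : ℝ, 0 < R ∧ ∀ n t, R ≤ t → P.real {ω | t ≤ |X (n + 1) ω - X n ω|} ≤ η := by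
  choose R hR hR' using fun i : ℕ =>
    tail_small P (fun ω => X (i + 1) ω - X i ω) ((hX _).sub (hX _)) η hη
  refine ⟨∑ i ∈ Finset.range τ, R i, ?_, ?_⟩
  · exact Finset.sum_pos (fun i _ => hR i) ⟨0, Finset.mem_range.2 hτ⟩
  · intro n t ht
    have h1 := incr_mod P X τ hcsi n (n % τ) (Nat.mod_modEq n τ).symm
    rw [real_eq P h1 t]
    apply hR'
    refine le_trans ?_ ht
    exact Finset.single_le_sum (fun i _ => (hR i).le) (Finset.mem_range.2 (Nat.mod_lt n hτ))

variable (X : ℕ → Ω → ℝ) (hXmeas : ∀ n, Measurable (X n))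
    (b : ℕ → ℝ) (hbpos : ∀ n : ℕ, 1 ≤ n → 0 < b n) (τ : ℕ) (hτ : 1 ≤ τ)
    (hss : ∀ (n : ℕ), 1 ≤ n → ∀ (m : ℕ),
      IdentDistrib (X (n * m)) (fun ω => b n * X m ω) P P)
    (hcsi : ∀ k m : ℕ, IdentDistrib (fun ω => X (m + 1) ω - X m ω)
      (fun ω => X (m + k * τ + 1) ω - X (m + k * τ) ω) P P)
    (hne : ¬ ∀ᵐ ω ∂P, X 1 ω = 0)

include hss in
lemma law_one (n : ℕ) (hn : 1 ≤ n) : IdentDistrib (X n) (fun ω => b n * X 1 ω) P P := by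
  have := hss n hn 1
  rwa [mul_one] at this

include hss hbpos in
lemma tail_X (n : ℕ) (hn : 1 ≤ n) (t : ℝ) :
    P.real {ω | t ≤ |X n ω|} = P.real {ω | t / b n ≤ |X 1 ω|} := by
  rw [real_eq P (law_one P X b hss n hn) t]
  congr 1
  ext ω
  simp only [Set.mem_ofPred_eq, abs_mul, abs_of_pos (hbpos n hn)]
  rw [div_le_iff₀ (hbpos n hn), mul_comm]

include hXmeas hbpos hss hne in
lemma b_mul (m n : ℕ) (hm : 1 ≤ m) (hn : 1 ≤ n) : b (m * n) = b m * b n := by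
  have hmn : 1 ≤ m * n := Nat.mul_pos hm hn
  have h1 := (law_one P X b hss (m * n) hmn).symm.trans (hss m hm n)
  have h2 := (law_one P X b hss n hn).comp (u := fun x : ℝ => b m * x) (by fun_prop)
  have h3 : IdentDistrib (fun ω => b (m * n) * X 1 ω) (fun ω => (b m * b n) * X 1 ω) P P := by
    have := h1.trans h2
    convert this using 2 with ω
    simp [mul_assoc]
  exact scale_unique P (X 1) (hXmeas 1) _ _ (hbpos _ hmn) (mul_pos (hbpos m hm) (hbpos n hn)) h3 hne

include hXmeas hbpos hss hne in
lemma b_one : b 1 = 1 := by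
  have := b_mul P X hXmeas b hbpos hss hne 1 1 le_rfl le_rfl
  have h := hbpos 1 le_rfl
  rw [mul_one] at this
  nlinarith

include hXmeas hbpos hss hne hcsi hτ in
lemma ratio_up (l : ℝ) (hl : 1 < l) : ∃ K : ℝ, ∀ n, 1 ≤ n → K ≤ b n → b (n + 1) ≤ l ^ 2 * b n := by
  by_contra hcon
  push Not at hcon
  apply hne
  apply zero_of_scale P (X 1) (hXmeas 1) l hl
  intro s hs
  apply le_of_forall_pos_le_add
  intro η hη
  obtain ⟨R, hR, hR'⟩ := incr_tight P X hXmeas τ hτ hcsi η hη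
  have hls : 0 < l * s * (l - 1) := by have := sub_pos.2 hl; positivity
  obtain ⟨n, hn, hKn, hbn⟩ := hcon (R / (l * s * (l - 1)))
  have hb0 := hbpos n hn
  have hb1 := hbpos (n + 1) (by omega)
  rw [div_le_iff₀ hls] at hKn
  have u := union_bound P (X (n + 1)) (X n) (fun ω => X (n + 1) ω - X n ω)
    (l ^ 2 * s * b n) (l * s * b n) R (fun ω => by
      have := abs_add_le (X n ω) (X (n + 1) ω - X n ω)
      simpa using this) (by nlinarith)
  rw [tail_X P X b hbpos hss _ hn, tail_X P X b hbpos hss _ (by omega : 1 ≤ n + 1),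
    mul_div_cancel_right₀ _ hb0.ne'] at u
  have h1 : P.real {ω | s ≤ |X 1 ω|} ≤ P.real {ω | l ^ 2 * s * b n / b (n + 1) ≤ |X 1 ω|} := by
    refine measureReal_mono ?_ (measure_ne_top _ _)
    intro ω hω
    simp only [Set.mem_ofPred_eq] at hω ⊢
    refine le_trans ?_ hω
    rw [div_le_iff₀ hb1]
    nlinarith
  have := hR' n R le_rfl
  linarith

include hXmeas hbpos hss hne hcsi hτ in
lemma ratio_down (l : ℝ) (hl : 1 < l) : ∃ K : ℝ, ∀ n, 1 ≤ n → K ≤ b n → b n ≤ l ^ 2 * b (n + 1) := by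
  by_contra hcon
  push Not at hcon
  apply hne
  apply zero_of_scale P (X 1) (hXmeas 1) l hl
  intro s hs
  apply le_of_forall_pos_le_add
  intro η hη
  obtain ⟨R, hR, hR'⟩ := incr_tight P X hXmeas τ hτ hcsi η hη
  have hls : 0 < s * (1 - 1 / l) := by
    have : 1 / l < 1 := by rw [div_lt_one (by linarith)]; exact hl
    have := sub_pos.2 this; positivity
  obtain ⟨n, hn, hKn, hbn⟩ := hcon (R / (s * (1 - 1 / l)))
  have hb0 := hbpos n hn
  have hb1 := hbpos (n + 1) (by omega)
  rw [div_le_iff₀ hls] at hKn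
  have u := union_bound P (X n) (X (n + 1)) (fun ω => X (n + 1) ω - X n ω)
    (s * b n) (s / l * b n) R (fun ω => by
      have := abs_sub (X (n + 1) ω) (X (n + 1) ω - X n ω)
      simpa using this) (by
        have : s / l * b n = s * b n - b n * (s * (1 - 1 / l)) := by field_simp; ring
        linarith)
  rw [tail_X P X b hbpos hss _ hn, tail_X P X b hbpos hss _ (by omega : 1 ≤ n + 1),
    mul_div_cancel_right₀ _ hb0.ne'] at u
  have h1 : P.real {ω | s / l * b n / b (n + 1) ≤ |X 1 ω|} ≤ P.real {ω | l * s ≤ |X 1 ω|} := by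
    refine measureReal_mono ?_ (measure_ne_top _ _)
    intro ω hω
    simp only [Set.mem_ofPred_eq] at hω ⊢
    refine le_trans ?_ hω
    rw [le_div_iff₀ hb1]
    have : l * s * b (n + 1) = s / l * (l ^ 2 * b (n + 1)) := by field_simp
    rw [this]
    gcongr
  have := hR' n R le_rfl
  linarith

include hXmeas hbpos hss hne hcsi hτ in
lemma log_diff (ε : ℝ) (hε : 0 < ε) : ∃ K : ℝ, ∀ n, 1 ≤ n → K ≤ Real.log (b n) →
    |Real.log (b (n + 1)) - Real.log (b n)| ≤ ε := by
  have hl : 1 < Real.exp (ε / 2) := by rw [Real.one_lt_exp_iff]; positivity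
  have hl2 : Real.exp (ε / 2) ^ 2 = Real.exp ε := by rw [← Real.exp_nat_mul]; congr 1; push_cast; ring
  obtain ⟨K1, hK1⟩ := ratio_up P X hXmeas b hbpos τ hτ hss hcsi hne _ hl
  obtain ⟨K2, hK2⟩ := ratio_down P X hXmeas b hbpos τ hτ hss hcsi hne _ hl
  rw [hl2] at hK1 hK2
  refine ⟨max K1 K2, fun n hn hK => ?_⟩
  have hb0 := hbpos n hn
  have hb1 := hbpos (n + 1) (by omega)
  have hle : max K1 K2 ≤ b n := by
    have := Real.add_one_le_exp (Real.log (b n))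
    rw [Real.exp_log hb0] at this
    linarith
  have h1 := Real.log_le_log hb1 (hK1 n hn ((le_max_left _ _).trans hle))
  have h2 := Real.log_le_log hb0 (hK2 n hn ((le_max_right _ _).trans hle))
  rw [Real.log_mul (Real.exp_pos _).ne' hb0.ne', Real.log_exp] at h1
  rw [Real.log_mul (Real.exp_pos _).ne' hb1.ne', Real.log_exp] at h2
  rw [abs_le]
  constructor <;> linarith

include hXmeas hbpos hss hne hcsi in
lemma incr_zero (hle : ∀ n : ℕ, 1 ≤ n → b n ≤ 1)
    (p q : ℕ) (hp : p.Prime) (hq : q.Prime) (hpq : p ≠ q) (hbp : b p < 1) (hbq : b q < 1)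
    (a c t n : ℕ) (hτe : τ = p ^ a * q ^ c * t) (hpt : p.Coprime t) (hqt : q.Coprime t)
    (hpn : p ^ a ∣ n) (hqn : q ^ c ∣ n + 1) (hτ0 : 1 ≤ τ) :
    ∀ᵐ ω ∂P, X (n + 1) ω - X n ω = 0 := by
  have hmul := b_mul P X hXmeas b hbpos hss hne
  have hb1 := b_one P X hXmeas b hbpos hss hne
  have hpow : ∀ t, 1 ≤ t → ∀ e : ℕ, b (t ^ e) = b t ^ e := by
    intro t ht e
    induction e with
    | zero => simp [hb1]
    | succ e ih => rw [pow_succ, hmul _ _ (Nat.one_le_pow _ _ ht) ht, ih, pow_succ]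
  have hdiv : ∀ (r K x : ℕ), 1 ≤ r → 1 ≤ x → r ^ K ∣ x → b x ≤ b r ^ K := by
    rintro r K x hr hx ⟨v, rfl⟩
    have hv1 : 1 ≤ v := by
      rcases Nat.eq_zero_or_pos v with h | h
      · simp [h] at hx
      · exact h
    rw [hmul _ _ (Nat.one_le_pow _ _ hr) hv1, hpow r hr]
    exact mul_le_of_le_one_right (pow_pos (hbpos r hr) K).le (hle v hv1)
  apply zero_of_tail
  intro s hs
  apply le_of_forall_pos_le_add
  intro η hη
  obtain ⟨R, hR, hR'⟩ := tail_small P (X 1) (hXmeas 1) (η / 2) (by positivity)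
  have hsR : 0 < s / 2 / R := by positivity
  obtain ⟨K1, hK1⟩ := exists_pow_lt_of_lt_one hsR hbp
  obtain ⟨K2, hK2⟩ := exists_pow_lt_of_lt_one hsR hbq
  obtain ⟨x0, hx1, hx2, hx3⟩ := crt3 p q a c t (max K1 K2) n hp hq hpq hpt hqt hpn hqn
  rw [← hτe] at hx3
  obtain ⟨x, hx, hpx, hqx, hxm⟩ : ∃ x, 1 ≤ x ∧ p ^ K1 ∣ x ∧ q ^ K2 ∣ x + 1 ∧ n ≡ x [MOD τ] := by
    refine ⟨x0 + p ^ K1 * q ^ K2 * τ, ?_, ?_, ?_, ?_⟩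
    · have := Nat.mul_pos (Nat.mul_pos (pow_pos hp.pos K1) (pow_pos hq.pos K2)) hτ0
      omega
    · exact dvd_add ((pow_dvd_pow p (le_max_left _ _)).trans hx1) ⟨q ^ K2 * τ, by ring⟩
    · rw [add_right_comm]
      exact dvd_add ((pow_dvd_pow q (le_max_right _ _)).trans hx2) ⟨p ^ K1 * τ, by ring⟩
    · exact hx3.symm.trans (by simp [Nat.ModEq])
  rw [real_eq P (incr_mod P X τ hcsi n x hxm) s]
  have u := union_bound P (fun ω => X (x + 1) ω - X x ω) (X (x + 1)) (X x) s (s / 2) (s / 2)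
    (fun ω => abs_sub _ _) (by linarith)
  rw [tail_X P X b hbpos hss _ hx, tail_X P X b hbpos hss _ (by omega : 1 ≤ x + 1)] at u
  have small : ∀ y, 0 < y → y < s / 2 / R → R ≤ s / 2 / y := by
    intro y hy hy2
    rw [lt_div_iff₀ hR] at hy2
    rw [le_div_iff₀ hy]; linarith
  have v1 := hR' _ (small (b x) (hbpos x hx) ((hdiv p K1 x hp.pos hx hpx).trans_lt hK1))
  have v2 := hR' _ (small (b (x + 1)) (hbpos _ (by omega))
    ((hdiv q K2 (x + 1) hq.pos (by omega) hqx).trans_lt hK2))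
  linarith

include hXmeas hbpos hss hne hcsi hτ in
lemma no_two (hle : ∀ n : ℕ, 1 ≤ n → b n ≤ 1)
    (p q : ℕ) (hp : p.Prime) (hq : q.Prime) (hpq : p ≠ q) (hbp : b p < 1) (hbq : b q < 1) : False := by
  have hmul := b_mul P X hXmeas b hbpos hss hne
  have hb1 := b_one P X hXmeas b hbpos hss hne
  have Z : ∀ a c t n, τ = p ^ a * q ^ c * t → p.Coprime t → q.Coprime t → p ^ a ∣ n →
      q ^ c ∣ n + 1 → 1 ≤ n → b n = b (n + 1) := by
    intro a c t n h1 h2 h3 h4 h5 hn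
    have h6 := incr_zero P X hXmeas b hbpos τ hss hcsi hne hle p q hp hq hpq hbp hbq a c t n
      h1 h2 h3 h4 h5 hτ
    have h7 : X n =ᵐ[P] X (n + 1) := by
      filter_upwards [h6] with ω hω
      linarith
    have h8 := IdentDistrib.of_ae_eq (hXmeas n).aemeasurable h7
    have h9 := ((law_one P X b hss n hn).symm.trans h8).trans
      (law_one P X b hss (n + 1) (by omega))
    exact scale_unique P (X 1) (hXmeas 1) _ _ (hbpos _ hn) (hbpos _ (by omega)) h9 hne
  have NP := new_prime b hbpos hb1 hmul hle τ hτ p q hp hq hpq hbp Z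
  obtain ⟨r, hr, hrτ, hbr⟩ := NP τ hτ
  obtain ⟨r', hr', hrτ', hbr'⟩ := NP (r * τ) (Nat.mul_pos hr.pos hτ)
  have hrr : r ≠ r' := by
    rintro rfl
    have := Nat.Coprime.coprime_mul_right_right hrτ'
    rw [Nat.coprime_self] at this
    exact hr.ne_one this
  have hall : ∀ n, ∀ᵐ ω ∂P, X (n + 1) ω - X n ω = 0 := fun n =>
    incr_zero P X hXmeas b hbpos τ hss hcsi hne hle r r' hr hr' hrr hbr hbr' 0 0 τ n
      (by simp) hrτ (Nat.Coprime.coprime_mul_left_right hrτ') (by simp) (by simp) hτ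
  have heq : ∀ n, X 1 =ᵐ[P] X (n + 1) := by
    intro n
    induction n with
    | zero => rfl
    | succ n ih =>
      filter_upwards [ih, hall (n + 1)] with ω h1 h2
      linarith
  have h7 := heq (p - 1)
  rw [Nat.sub_add_cancel hp.pos] at h7
  have h8 := IdentDistrib.of_ae_eq (hXmeas 1).aemeasurable h7
  have h9 := ((law_one P X b hss 1 le_rfl).symm.trans h8).trans (law_one P X b hss p hp.pos)
  have := scale_unique P (X 1) (hXmeas 1) _ _ (hbpos _ le_rfl) (hbpos _ hp.pos) h9 hne
  linarith

end prob

lemma padic_facts (p : ℕ) (hp : p.Prime) (n : ℕ) (hn : 1 ≤ n) :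
    padicNormNat p n = (p : ℝ) ^ (-(padicValNat p n : ℝ)) := by
  have : Fact p.Prime := ⟨hp⟩
  have h : (n : ℚ) ≠ 0 := by exact_mod_cast (by omega : n ≠ 0)
  unfold padicNormNat
  rw [padicNorm.eq_zpow_of_nonzero h, padicValRat.of_nat]
  rw [Rat.cast_zpow, ← Real.rpow_intCast, Rat.cast_natCast, Int.cast_neg, Int.cast_natCast]

lemma typeII_self {p : ℕ} {b : ℕ → ℝ} (h : IsTypeII p b) : b p < 1 := by
  obtain ⟨hp, H, hH, h⟩ := h
  have : Fact p.Prime := ⟨hp⟩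
  have hp1 : (1 : ℝ) < p := by exact_mod_cast hp.one_lt
  rw [h p hp.pos, padic_facts p hp p hp.pos, padicValNat_self]
  apply Real.rpow_lt_one (by positivity) _ hH
  exact Real.rpow_lt_one_of_one_lt_of_neg hp1 (by norm_num)

lemma typeII_other {p : ℕ} {b : ℕ → ℝ} (h : IsTypeII p b) (q : ℕ) (hq : q.Prime) (hpq : p ≠ q) :
    b q = 1 := by
  obtain ⟨hp, H, hH, h⟩ := h
  have : Fact p.Prime := ⟨hp⟩
  have : Fact q.Prime := ⟨hq⟩
  rw [h q hq.pos, padic_facts p hp q hq.pos, padicValNat_primes hpq]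
  simp

lemma typeIII_gt {b : ℕ → ℝ} (h : IsTypeIII b) (n : ℕ) (hn : 2 ≤ n) : 1 < b n := by
  obtain ⟨H, hH, h⟩ := h
  rw [h n (by omega)]
  exact Real.one_lt_rpow (by exact_mod_cast hn) hH

lemma trichotomy_exact (b : ℕ → ℝ) (h : IsTypeI b ∨ (∃ p, IsTypeII p b) ∨ IsTypeIII b) :
    (IsTypeI b ∧ ¬ (∃ p : ℕ, IsTypeII p b) ∧ ¬ IsTypeIII b) ∨
    ((¬ IsTypeI b) ∧ (∃! p : ℕ, IsTypeII p b) ∧ ¬ IsTypeIII b) ∨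
    ((¬ IsTypeI b) ∧ ¬ (∃ p : ℕ, IsTypeII p b) ∧ IsTypeIII b) := by
  have h12 : ∀ p, IsTypeII p b → ¬ IsTypeI b := fun p h2 h1 => by
    have := typeII_self h2
    rw [h1 p h2.1.pos] at this
    exact lt_irrefl _ this
  have h13 : IsTypeIII b → ¬ IsTypeI b := fun h3 h1 => by
    have := typeIII_gt h3 2 le_rfl
    rw [h1 2 (by norm_num)] at this
    exact lt_irrefl _ this
  have h23 : ∀ p, IsTypeII p b → ¬ IsTypeIII b := fun p h2 h3 => by
    have := typeII_self h2
    have := typeIII_gt h3 p h2.1.two_le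
    linarith
  rcases h with h | ⟨p, h⟩ | h
  · exact Or.inl ⟨h, fun ⟨p, h2⟩ => h12 p h2 h, fun h3 => h13 h3 h⟩
  · refine Or.inr (Or.inl ⟨h12 p h, ⟨p, h, fun q hq => ?_⟩, h23 p h⟩)
    by_contra hne
    have h1 := typeII_other hq p h.1 hne
    have h2 := typeII_self h
    linarith
  · exact Or.inr (Or.inr ⟨h13 h, fun ⟨p, h2⟩ => h23 p h2 h, h⟩)

lemma typeII_of (b : ℕ → ℝ) (hbpos : ∀ n : ℕ, 1 ≤ n → 0 < b n) (hb1 : b 1 = 1)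
    (hmul : ∀ m n, 1 ≤ m → 1 ≤ n → b (m * n) = b m * b n)
    (p : ℕ) (hp : p.Prime) (hbp : b p < 1) (hoth : ∀ q, q.Prime → q ≠ p → b q = 1) :
    IsTypeII p b := by
  have hp1 : (1 : ℝ) < p := by exact_mod_cast hp.one_lt
  have hp0 : (0 : ℝ) < p := by linarith
  have hlp := Real.log_pos hp1
  have hb0 := hbpos p hp.pos
  refine ⟨hp, -Real.log (b p) / Real.log p, ?_, ?_⟩
  · exact div_pos (neg_pos.2 (Real.log_neg hb0 hbp)) hlp
  intro n hn
  have : Fact p.Prime := ⟨hp⟩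
  have hpow : ∀ e : ℕ, b (p ^ e) = b p ^ e := by
    intro e
    induction e with
    | zero => simp [hb1]
    | succ e ih => rw [pow_succ, hmul _ _ (Nat.one_le_pow _ _ hp.pos) hp.pos, ih, pow_succ]
  obtain ⟨a, w, hpw, hw⟩ := Nat.exists_eq_pow_mul_and_not_dvd (n := n) (by omega) p hp.ne_one
  have hw1 : 1 ≤ w := by
    rcases Nat.eq_zero_or_pos w with h | h
    · simp [h] at hpw
    · exact h
  have hbw : b w = 1 := by
    by_contra hcon
    obtain ⟨r, hr, hrw, hbr⟩ := exists_prime_ne_one b hb1 hmul w hw1 hcon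
    apply hbr
    apply hoth r hr
    rintro rfl
    exact hpw hrw
  have hval : padicValNat p n = a := by
    rw [hw, padicValNat.mul (pow_ne_zero _ hp.ne_zero) (by omega), padicValNat.prime_pow,
      padicValNat.eq_zero_of_not_dvd hpw, add_zero]
  rw [padic_facts p hp n hn, hval, hw, hmul _ _ (Nat.one_le_pow _ _ hp.pos) hw1, hbw, hpow, mul_one,
    ← Real.rpow_mul hp0.le, Real.rpow_def_of_pos hp0]
  rw [show Real.log p * (-(a : ℝ) * (-Real.log (b p) / Real.log p)) = a * Real.log (b p) by
    field_simp]
  rw [Real.exp_nat_mul, Real.exp_log hb0]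

/-- Classification of scaling functions of marginally self-similar processes with
marginally cyclostationary increments: exactly one of the three types occurs. -/
theorem stmt0 {Ω : Type*} [MeasurableSpace Ω] (P : Measure Ω) [IsProbabilityMeasure P]
    (X : ℕ → Ω → ℝ) (hXmeas : ∀ n, Measurable (X n))
    (b : ℕ → ℝ) (hbpos : ∀ n : ℕ, 1 ≤ n → 0 < b n) (τ : ℕ) (hτ : 1 ≤ τ)
    (hss : ∀ (n : ℕ), 1 ≤ n → ∀ (m : ℕ),
      IdentDistrib (X (n * m)) (fun ω => b n * X m ω) P P)
    (hcsi : ∀ k m : ℕ, IdentDistrib (fun ω => X (m + 1) ω - X m ω)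
      (fun ω => X (m + k * τ + 1) ω - X (m + k * τ) ω) P P)
    (hnd : P {ω | X 1 ω = 0} < 1) :
    (IsTypeI b ∧ ¬ (∃ p : ℕ, IsTypeII p b) ∧ ¬ IsTypeIII b) ∨
    ((¬ IsTypeI b) ∧ (∃! p : ℕ, IsTypeII p b) ∧ ¬ IsTypeIII b) ∨
    ((¬ IsTypeI b) ∧ ¬ (∃ p : ℕ, IsTypeII p b) ∧ IsTypeIII b) := by
  have hne : ¬ ∀ᵐ ω ∂P, X 1 ω = 0 := by
    intro h
    have h1 : P {ω | X 1 ω = 0} = 1 :=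
      (prob_compl_eq_zero_iff ((hXmeas 1) (measurableSet_singleton 0))).1 h
    rw [h1] at hnd
    exact lt_irrefl _ hnd
  have hmul := b_mul P X hXmeas b hbpos hss hne
  have hb1 := b_one P X hXmeas b hbpos hss hne
  apply trichotomy_exact
  by_cases hgt : ∃ r, 1 ≤ r ∧ 1 < b r
  · obtain ⟨r, hr, hbr⟩ := hgt
    have hr2 : 2 ≤ r := by
      rcases Nat.lt_or_ge r 2 with h | h
      · have : r = 1 := by omega
        rw [this, hb1] at hbr
        exact absurd hbr (lt_irrefl _)
      · exact h
    have hlr : 0 < Real.log r := Real.log_pos (by exact_mod_cast hr2)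
    have hfr := Real.log_pos hbr
    have hlog := aux_log (fun n => Real.log (b n))
      (fun m n hm hn => by
        simp only [hmul m n hm hn]
        exact Real.log_mul (hbpos m hm).ne' (hbpos n hn).ne')
      r hr2 hfr (log_diff P X hXmeas b hbpos τ hτ hss hcsi hne)
    refine Or.inr (Or.inr ⟨Real.log (b r) / Real.log r, div_pos hfr hlr, fun n hn => ?_⟩)
    rcases Nat.lt_or_ge n 2 with h | h
    · have : n = 1 := by omega
      subst this
      simp [hb1]
    · have h1 := hlog n h
      rw [Real.rpow_def_of_pos (by exact_mod_cast hn), mul_comm, ← h1, Real.exp_log (hbpos n hn)]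
  · push Not at hgt
    by_cases hI : IsTypeI b
    · exact Or.inl hI
    · unfold IsTypeI at hI
      push Not at hI
      obtain ⟨n, hn, hbn⟩ := hI
      obtain ⟨p, hp, -, hbp⟩ := exists_prime_ne_one b hb1 hmul n hn hbn
      have hbp' := lt_of_le_of_ne (hgt p hp.pos) hbp
      refine Or.inr (Or.inl ⟨p, typeII_of b hbpos hb1 hmul p hp hbp' fun q hq hqp => ?_⟩)
      by_contra hbq
      exact no_two P X hXmeas b hbpos τ hτ hss hcsi hne hgt p q hp hq (Ne.symm hqp) hbp'
        (lt_of_le_of_ne (hgt q hq.pos) hbq)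
end
end

section
/- Let b : ℕ → (0,∞) be completely multiplicative and suppose that either (1) b(n) = 1 for all n ∈ ℕ, or (2) b(n) = (|n|_p)^H for all n ∈ ℕ for some prime p and some H > 0, or (3) b(n) = n^H for all n ∈ ℕ for some H > 0. Then there exist a probability space and a dt-ss-si process (X_n)_{n∈ℕ₀} on it whose scaling function is b and for which the law of X₁ is not a point mass. -/
open MeasureTheory ProbabilityTheory Filter

noncomputable section

/-! Part 1: generalities and the first two cases. -/

lemma ne_dirac_of_flip {Ω : Type} [MeasurableSpace Ω] (P : Measure Ω) [IsProbabilityMeasure P]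
    (Y : Ω → ℝ) (hY : Measurable Y) (τ : Ω → Ω) (hτ : MeasurePreserving τ P P)
    (hne : ∀ ω, Y (τ ω) ≠ Y ω) (c : ℝ) : Measure.map Y P ≠ Measure.dirac c := by
  intro h
  have h1 : ∀ᵐ y ∂(Measure.map Y P), y = c := by
    rw [h]; exact (ae_dirac_iff (measurableSet_singleton c)).2 rfl
  have h2 : ∀ᵐ ω ∂P, Y ω = c := ae_of_ae_map hY.aemeasurable h1
  have h3 : ∀ᵐ ω ∂P, Y (τ ω) = c := hτ.quasiMeasurePreserving.ae h2
  obtain ⟨ω, h4, h5⟩ := (h2.and h3).exists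
  exact hne ω (h5.trans h4.symm)

/-- The fair coin. -/
def coin : Measure Bool := (2⁻¹ : ENNReal) • (Measure.dirac true + Measure.dirac false)

instance : IsProbabilityMeasure coin := ⟨by
  simp only [coin, Measure.smul_apply, Measure.add_apply, measure_univ, smul_eq_mul]
  rw [one_add_one_eq_two, ENNReal.inv_mul_cancel (by simp) (by simp)]⟩

lemma coin_flip : Measure.map (fun x : Bool => !x) coin = coin := by
  have hm : Measurable (fun x : Bool => !x) := measurable_of_countable _
  rw [coin, Measure.map_smul, Measure.map_add _ _ hm, Measure.map_dirac' hm,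
    Measure.map_dirac' hm, add_comm]
  rfl

/-- Real value of a coin. -/
def bval (x : Bool) : ℝ := if x then 1 else 0

lemma bval_not_ne (x : Bool) : bval (!x) ≠ bval x := by cases x <;> simp [bval]

lemma bval_nonneg (x : Bool) : 0 ≤ bval x := by cases x <;> simp [bval]
lemma bval_le_one (x : Bool) : bval x ≤ 1 := by cases x <;> simp [bval]

lemma case_one (b : ℕ → ℝ) (h : ∀ n : ℕ, 1 ≤ n → b n = 1) :
    ∃ (Ω : Type) (_ : MeasurableSpace Ω) (P : Measure Ω),
      IsProbabilityMeasure P ∧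
      ∃ X : ℕ → Ω → ℝ, (∀ n, Measurable (X n)) ∧
        SelfSimilar P X b ∧ StationaryIncrements P X ∧
        ∀ c : ℝ, Measure.map (X 1) P ≠ Measure.dirac c := by
  refine ⟨Bool, inferInstance, coin, inferInstance, fun _ => bval,
    fun _ => measurable_of_countable _, ?_, ?_, ?_⟩
  · intro n hn
    simp [EqDistFam, h n hn]
  · intro n hn
    simp [EqDistFam]
  · exact ne_dirac_of_flip coin bval (measurable_of_countable _) (fun x => !x)
      ⟨measurable_of_countable _, coin_flip⟩ bval_not_ne

/-- coin tossing space -/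
def coinsMeas : Measure (ℕ × ℕ → Bool) := Measure.infinitePi (fun _ => coin)

instance : IsProbabilityMeasure coinsMeas := by unfold coinsMeas; infer_instance

lemma coins_inj (σ : ℕ × ℕ → ℕ × ℕ) (hσ : Function.Injective σ) :
    MeasurePreserving (fun (ω : ℕ × ℕ → Bool) i => ω (σ i)) coinsMeas coinsMeas :=
  ⟨by fun_prop, Measure.map_infinitePi_infinitePi_of_inj hσ⟩

lemma coins_flip : MeasurePreserving
    (fun (ω : ℕ × ℕ → Bool) i => if i = (0, 1) then !(ω i) else ω i) coinsMeas coinsMeas := by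
  have hm : ∀ i : ℕ × ℕ, Measurable (fun x : Bool => if i = (0, 1) then !x else x) :=
    fun i => measurable_of_countable _
  refine ⟨measurable_pi_lambda _ fun i => (hm i).comp (measurable_pi_apply i), ?_⟩
  have := Measure.infinitePi_map_pi (fun _ : ℕ × ℕ => coin) hm
  unfold coinsMeas
  rw [this]
  congr 1
  ext1 i
  by_cases hi : i = (0, 1)
  · simp only [hi, if_true]; exact coin_flip
  · simp only [hi, if_false]; exact Measure.map_id

/-- The `p`-adic process. -/
def padicProc (p : ℕ) (c : ℝ) (n : ℕ) (ω : ℕ × ℕ → Bool) : ℝ :=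
  ∑' k : ℕ, c ^ k * (bval (ω (k, n % p ^ (k + 1))) - bval (ω (k, 0)))

lemma padic_summable (c : ℝ) (hc0 : 0 ≤ c) (hc1 : c < 1) (ω : ℕ × ℕ → Bool) (u v : ℕ → ℕ × ℕ) :
    Summable (fun k => c ^ k * (bval (ω (u k)) - bval (ω (v k)))) := by
  refine Summable.of_norm_bounded (summable_geometric_of_lt_one hc0 hc1) fun k => ?_
  rw [norm_mul, norm_pow, Real.norm_of_nonneg hc0]
  refine mul_le_of_le_one_right (by positivity) ?_
  rw [Real.norm_eq_abs, abs_le]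
  constructor <;> linarith [bval_nonneg (ω (u k)), bval_nonneg (ω (v k)),
    bval_le_one (ω (u k)), bval_le_one (ω (v k))]

lemma padic_measurable (p : ℕ) (c : ℝ) (n : ℕ) : Measurable (padicProc p c n) := by
  unfold padicProc
  have hb : Measurable bval := measurable_of_countable _
  refine Measurable.tsum fun k => ?_
  fun_prop

/-- If scaling is realized by measure preserving maps. -/
lemma ss_of_maps {Ω : Type} [MeasurableSpace Ω] (P : Measure Ω) (X : ℕ → Ω → ℝ)
    (hX : ∀ n, Measurable (X n)) (b : ℕ → ℝ)
    (h : ∀ n, 1 ≤ n → ∃ T : Ω → Ω, MeasurePreserving T P P ∧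
      ∀ m ω, X (n * m) ω = b n * X m (T ω)) : SelfSimilar P X b := by
  intro n hn
  obtain ⟨T, hT, hT2⟩ := h n hn
  unfold EqDistFam
  simp_rw [hT2]
  have hm : Measurable (fun ω m => b n * X m ω) := by fun_prop
  conv_rhs => rw [← hT.map_eq, Measure.map_map hm hT.measurable]
  rfl

lemma si_of_maps {Ω : Type} [MeasurableSpace Ω] (P : Measure Ω) (X : ℕ → Ω → ℝ)
    (hX : ∀ n, Measurable (X n))
    (h : ∀ k, 1 ≤ k → ∃ T : Ω → Ω, MeasurePreserving T P P ∧
      ∀ m ω, X (m + k) ω - X k ω = X m (T ω)) : StationaryIncrements P X := by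
  intro n hn
  obtain ⟨T, hT, hT2⟩ := h n hn
  unfold EqDistFam
  have : (fun ω i => X (i + n + 1) ω - X (i + n) ω) =
      (fun ω m => X (m + 1) ω - X m ω) ∘ T := by
    ext ω m
    simp only [Function.comp]
    rw [← hT2, ← hT2, add_right_comm]
    ring
  have hm : Measurable (fun ω m => X (m + 1) ω - X m ω) := by fun_prop
  rw [this, ← Measure.map_map hm hT.measurable, hT.map_eq]

lemma padic_shift_inj (p k : ℕ) (hp : p.Prime) : Function.Injective
    (fun i : ℕ × ℕ => (i.1, if i.2 < p ^ (i.1 + 1) then (i.2 + k) % p ^ (i.1 + 1) else i.2)) := by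
  rintro ⟨j, r⟩ ⟨j', r'⟩ h
  simp only [Prod.mk.injEq] at h
  obtain ⟨rfl, h⟩ := h
  have hpos : 0 < p ^ (j + 1) := pow_pos hp.pos _
  have h1 := Nat.mod_lt (r + k) hpos
  have h2 := Nat.mod_lt (r' + k) hpos
  split_ifs at h with ha hb hb
  · have : r + k ≡ r' + k [MOD p ^ (j + 1)] := h
    have := Nat.ModEq.add_right_cancel' k this
    rw [Nat.ModEq, Nat.mod_eq_of_lt ha, Nat.mod_eq_of_lt hb] at this
    rw [this]
  · omega
  · omega
  · rw [h]

lemma padic_scale_inj (p v u : ℕ) (hp : p.Prime) (hu : Nat.Coprime p u) : Function.Injective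
    (fun i : ℕ × ℕ => (i.1 + v, if i.2 < p ^ (i.1 + 1) then
      (p ^ v * u * i.2) % p ^ (i.1 + v + 1) else i.2 * p ^ v)) := by
  rintro ⟨j, r⟩ ⟨j', r'⟩ h
  simp only [Prod.mk.injEq, add_left_inj] at h
  obtain ⟨rfl, h⟩ := h
  have hpv : 0 < p ^ v := pow_pos hp.pos _
  have e : p ^ (j + v + 1) = p ^ v * p ^ (j + 1) := by ring
  have key : ∀ s, (p ^ v * u * s) % p ^ (j + v + 1) = p ^ v * ((u * s) % p ^ (j + 1)) := by
    intro s
    rw [e, mul_assoc, Nat.mul_mod_mul_left]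
  have hpos : 0 < p ^ (j + 1) := pow_pos hp.pos _
  have h1 := Nat.mod_lt (u * r) hpos
  have h2 := Nat.mod_lt (u * r') hpos
  simp only [key, mul_comm _ (p ^ v)] at h
  have h' := h
  split_ifs at h with ha hb hb
  · have h := Nat.eq_of_mul_eq_mul_left hpv h
    have : u * r ≡ u * r' [MOD p ^ (j + 1)] := h
    have := Nat.ModEq.cancel_left_of_coprime (Nat.Coprime.pow_left _ hu) this
    rw [Nat.ModEq, Nat.mod_eq_of_lt ha, Nat.mod_eq_of_lt hb] at this
    rw [this]
  · have h := Nat.eq_of_mul_eq_mul_left hpv h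
    omega
  · have h := Nat.eq_of_mul_eq_mul_left hpv h
    omega
  · have h := Nat.eq_of_mul_eq_mul_left hpv h
    rw [h]

lemma case_two (b : ℕ → ℝ) (p : ℕ) (hp : p.Prime) (H : ℝ) (hH : 0 < H)
    (h : ∀ n : ℕ, 1 ≤ n → b n = (padicNormNat p n) ^ H) :
    ∃ (Ω : Type) (_ : MeasurableSpace Ω) (P : Measure Ω),
      IsProbabilityMeasure P ∧
      ∃ X : ℕ → Ω → ℝ, (∀ n, Measurable (X n)) ∧
        SelfSimilar P X b ∧ StationaryIncrements P X ∧
        ∀ c : ℝ, Measure.map (X 1) P ≠ Measure.dirac c := by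
  have hp1 : (1 : ℝ) < p := by exact_mod_cast hp.one_lt
  set c : ℝ := ((p : ℝ)⁻¹) ^ H with hc
  have hc0 : 0 < c := by positivity
  have hc1 : c < 1 := Real.rpow_lt_one (by positivity) (inv_lt_one_of_one_lt₀ hp1) hH
  refine ⟨ℕ × ℕ → Bool, inferInstance, coinsMeas, inferInstance, padicProc p c,
    padic_measurable p c, ?_, ?_, ?_⟩
  · refine ss_of_maps _ _ (padic_measurable p c) _ fun n hn => ?_
    obtain ⟨v, u, hu, hnu⟩ := Nat.exists_eq_pow_mul_and_not_dvd (n := n) (by omega) p hp.ne_one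
    have hcop : Nat.Coprime p u := (Nat.Prime.coprime_iff_not_dvd hp).2 hu
    refine ⟨_, coins_inj _ (padic_scale_inj p v u hp hcop), fun m ω => ?_⟩
    have hbn : b n = c ^ v := by
      have : Fact p.Prime := ⟨hp⟩
      have hv : padicNorm p (n : ℚ) = ((p : ℚ)⁻¹) ^ v := by
        have hu0 : padicNorm p ((u : ℤ) : ℚ) = 1 := by
          rw [padicNorm.int_eq_one_iff]
          exact_mod_cast hu
        rw [hnu]
        push_cast at hu0 ⊢
        rw [padicNorm.mul, hu0, mul_one]
        have := padicNorm.padicNorm_p (p := p) hp.one_lt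
        clear hnu
        induction v with
        | zero => simp
        | succ v ih => rw [pow_succ, padicNorm.mul, ih, this, pow_succ]
      rw [h n hn, padicNormNat, hv]
      push_cast
      rw [hc, ← Real.rpow_natCast, ← Real.rpow_natCast, ← Real.rpow_mul (by positivity),
        ← Real.rpow_mul (by positivity), mul_comm]
    rw [hbn]
    unfold padicProc
    have hs := padic_summable c hc0.le hc1 ω (fun k => (k, n * m % p ^ (k + 1))) (fun k => (k, 0))
    rw [← hs.sum_add_tsum_nat_add v, ← tsum_mul_left, Finset.sum_eq_zero, zero_add]
    · refine tsum_congr fun k => ?_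
      have hpos : 0 < p ^ (k + 1) := pow_pos hp.pos _
      simp only [Nat.mod_lt _ hpos, if_true, hpos, mul_zero, Nat.zero_mod]
      have e : p ^ (k + v + 1) = p ^ v * p ^ (k + 1) := by ring
      have : n * m % p ^ (k + v + 1) = p ^ v * u * (m % p ^ (k + 1)) % p ^ (k + v + 1) := by
        rw [hnu, e, mul_assoc, mul_assoc, Nat.mul_mod_mul_left, Nat.mul_mod_mul_left]
        simp [Nat.mul_mod]
      rw [this]
      ring
    · intro k hk
      have hk : k + 1 ≤ v := Finset.mem_range.1 hk
      have : p ^ (k + 1) ∣ n * m := by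
        rw [hnu]
        exact Dvd.dvd.mul_right (Dvd.dvd.mul_right (pow_dvd_pow p hk) _) _
      simp [Nat.mod_eq_zero_of_dvd this]
  · refine si_of_maps _ _ (padic_measurable p c) fun k hk => ?_
    refine ⟨_, coins_inj _ (padic_shift_inj p k hp), fun m ω => ?_⟩
    unfold padicProc
    rw [← Summable.tsum_sub (padic_summable c hc0.le hc1 ω _ _)
      (padic_summable c hc0.le hc1 ω _ _)]
    refine tsum_congr fun j => ?_
    have hpos : 0 < p ^ (j + 1) := pow_pos hp.pos _
    simp only [Nat.mod_lt _ hpos, if_true, hpos, zero_add, Nat.mod_add_mod]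
    ring
  · refine ne_dirac_of_flip coinsMeas _ (padic_measurable p c 1) _ coins_flip fun ω => ?_
    unfold padicProc
    rw [← sub_ne_zero, ← Summable.tsum_sub (padic_summable c hc0.le hc1
      (fun i => if i = (0, 1) then !(ω i) else ω i)
      (fun k => (k, 1 % p ^ (k + 1))) (fun k => (k, 0)))
      (padic_summable c hc0.le hc1 ω _ _), tsum_eq_single 0]
    · have h1 : 1 % p = 1 := Nat.mod_eq_of_lt hp.one_lt
      simp [h1, sub_ne_zero, bval_not_ne]
    · intro j hj
      simp [hj]

/-! Part 2: Poisson integrals. -/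

lemma lintegral_poisson (r : NNReal) (f : ℕ → ENNReal) :
    ∫⁻ n, f n ∂(poissonMeasure r) =
      ∑' n : ℕ, ENNReal.ofReal (Real.exp (-r) * r ^ n / (Nat.factorial n : ℝ)) * f n := by
  rw [poissonMeasure, lintegral_sum_measure]
  simp

lemma lintegral_poisson_id (r : NNReal) :
    ∫⁻ n, (n : ENNReal) ∂(poissonMeasure r) = r := by
  have h1 : ∑' n : ℕ, ENNReal.ofReal (Real.exp (-r) * r ^ n / (Nat.factorial n : ℝ)) = 1 := by
    have := lintegral_poisson r (fun _ => 1)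
    simpa using this.symm
  rw [lintegral_poisson, tsum_eq_zero_add' ENNReal.summable]
  have : ∀ n : ℕ, ENNReal.ofReal (Real.exp (-r) * r ^ (n + 1) / (Nat.factorial (n + 1) : ℝ))
      * ((n + 1 : ℕ) : ENNReal) =
      r * ENNReal.ofReal (Real.exp (-r) * r ^ n / (Nat.factorial n : ℝ)) := by
    intro n
    rw [← ENNReal.ofReal_natCast, ← ENNReal.ofReal_mul (by positivity),
      ← ENNReal.ofReal_coe_nnreal, ← ENNReal.ofReal_mul (by positivity)]
    congr 1
    rw [Nat.factorial_succ]
    push_cast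
    field_simp
    ring
  simp_rw [this]
  rw [ENNReal.tsum_mul_left, h1]
  simp

section Poisson

set_option linter.unusedSectionVars false

variable {E : Type} [MeasurableSpace E]

/-- sum over one block -/
def blockSum {M : Type} [AddCommMonoid M] (g : E → M) (q : ℕ × (ℕ → E)) : M :=
  ∑ i ∈ Finset.range q.1, g (q.2 i)

lemma blockSum_measurable_real (g : E → ℝ) (hg : Measurable g) : Measurable (blockSum g) := by
  refine measurable_from_prod_countable_right fun n => ?_
  simp only [blockSum]
  fun_prop

lemma blockSum_measurable_ennreal (g : E → ENNReal) (hg : Measurable g) :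
    Measurable (blockSum g) := by
  refine measurable_from_prod_countable_right fun n => ?_
  simp only [blockSum]
  fun_prop

/-- law of one block -/
def blockMeas (r : NNReal) (ν : Measure E) [IsProbabilityMeasure ν] : Measure (ℕ × (ℕ → E)) :=
  (poissonMeasure r).prod (Measure.infinitePi fun _ => ν)

instance (r : NNReal) (ν : Measure E) [IsProbabilityMeasure ν] :
    IsProbabilityMeasure (blockMeas r ν) := by unfold blockMeas; infer_instance

lemma block_lintegral (r : NNReal) (ν : Measure E) [IsProbabilityMeasure ν] (g : E → ENNReal)
    (hg : Measurable g) : ∫⁻ q, blockSum g q ∂(blockMeas r ν) = r * ∫⁻ x, g x ∂ν := by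
  unfold blockMeas
  rw [lintegral_prod _ (blockSum_measurable_ennreal g hg).aemeasurable]
  have : ∀ n : ℕ, ∫⁻ y, blockSum g (n, y) ∂(Measure.infinitePi fun _ : ℕ => ν) =
      n * ∫⁻ x, g x ∂ν := by
    intro n
    simp only [blockSum]
    rw [lintegral_finsetSum _ (fun i _ => by fun_prop)]
    have : ∀ i : ℕ, ∫⁻ y, g (y i) ∂(Measure.infinitePi fun _ : ℕ => ν) = ∫⁻ x, g x ∂ν :=
      fun i => (measurePreserving_eval_infinitePi (fun _ : ℕ => ν) i).lintegral_comp hg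
    simp [this]
  simp_rw [this]
  rw [lintegral_mul_const _ (measurable_of_countable _), lintegral_poisson_id]

lemma prod_integral {F : ℕ → Type} [∀ i, MeasurableSpace (F i)] (Q : ∀ i, Measure (F i))
    [∀ i, IsProbabilityMeasure (Q i)] (φ : ∀ i, F i → ℂ) (hφ : ∀ i, Measurable (φ i)) (n : ℕ) :
    ∫ ω, ∏ i ∈ Finset.range n, φ i (ω i) ∂(Measure.infinitePi Q) =
      ∏ i ∈ Finset.range n, ∫ x, φ i x ∂(Q i) := by
  have h1 : iIndepFun (fun i (ω : ∀ i, F i) => φ i (ω i)) (Measure.infinitePi Q) :=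
    iIndepFun_infinitePi hφ
  have h2 := h1.precomp (g := fun i : Fin n => (i : ℕ)) Fin.val_injective
  have h3 := h2.integral_fun_prod_eq_prod_integral (fun i => by
    have : Measurable (fun ω : ∀ i, F i => φ i (ω i)) := (hφ i).comp (measurable_pi_apply _)
    exact this.aestronglyMeasurable)
  simp_rw [Finset.prod_range]
  refine h3.trans ?_
  refine Finset.prod_congr rfl fun i _ => ?_
  have hp := measurePreserving_eval_infinitePi Q i
  rw [← hp.map_eq, integral_map hp.measurable.aemeasurable]
  exact (hφ i).aestronglyMeasurable

lemma block_char (r : NNReal) (ν : Measure E) [IsProbabilityMeasure ν] (g : E → ℝ)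
    (hg : Measurable g) : ∫ q, Complex.exp (Complex.I * (blockSum g q : ℝ)) ∂(blockMeas r ν) =
      Complex.exp (r * (∫ x, Complex.exp (Complex.I * g x) ∂ν - 1)) := by
  unfold blockMeas
  have hm := blockSum_measurable_real g hg
  have hInt : Integrable (fun q => Complex.exp (Complex.I * (blockSum g q : ℝ)))
      ((poissonMeasure r).prod (Measure.infinitePi fun _ => ν)) := by
    refine Integrable.of_bound (C := 1) ?_ (ae_of_all _ fun q => ?_)
    · exact (by fun_prop : Measurable _).aestronglyMeasurable
    · rw [mul_comm, Complex.norm_exp_ofReal_mul_I]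
  rw [integral_prod _ hInt]
  set z := ∫ x, Complex.exp (Complex.I * g x) ∂ν with hz
  have : ∀ n : ℕ, ∫ y, Complex.exp (Complex.I * (blockSum g (n, y) : ℝ))
      ∂(Measure.infinitePi fun _ : ℕ => ν) = z ^ n := by
    intro n
    have h := prod_integral (fun _ : ℕ => ν) (fun _ x => Complex.exp (Complex.I * g x))
      (fun _ => by fun_prop) n
    rw [Finset.prod_const, Finset.card_range] at h
    rw [hz, ← h]
    refine integral_congr_ae (ae_of_all _ fun y => ?_)
    simp only [blockSum]
    push_cast
    rw [Finset.mul_sum, Complex.exp_sum]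
  simp_rw [this]
  rw [integral_poissonMeasure]
  have h2 : ∀ n : ℕ, (Real.exp (-r) * r ^ n / (Nat.factorial n : ℝ)) • z ^ n =
      Complex.exp (-r) * ((r * z) ^ n / (Nat.factorial n : ℂ)) := by
    intro n
    rw [Complex.real_smul]
    push_cast
    rw [mul_pow]
    ring
  simp_rw [h2]
  rw [tsum_mul_left, mul_sub, sub_eq_neg_add, mul_one, Complex.exp_add, Complex.exp_eq_exp_ℂ]
  congr 1
  rw [NormedSpace.exp_eq_tsum_div]

/-- the class of functions for which the Poisson integral converges -/
def PInt (μ : Measure E) (g : E → ℝ) : Prop :=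
  Measurable g ∧ ∫⁻ x, min ‖g x‖ₑ 1 ∂μ ≠ ⊤

lemma min_add_le (a b : ENNReal) : min (a + b) 1 ≤ min a 1 + min b 1 := by
  rcases le_total a 1 with ha | ha
  · rcases le_total b 1 with hb | hb
    · rw [min_eq_left ha, min_eq_left hb]; exact min_le_left _ _
    · rw [min_eq_right hb]; exact (min_le_right _ _).trans le_add_self
  · rw [min_eq_right ha]; exact (min_le_right _ _).trans le_self_add

lemma PInt.add {μ : Measure E} {g h : E → ℝ} (hg : PInt μ g) (hh : PInt μ h) :
    PInt μ (fun x => g x + h x) := by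
  refine ⟨hg.1.add hh.1, ne_top_of_le_ne_top (ENNReal.add_ne_top.2 ⟨hg.2, hh.2⟩) ?_⟩
  have hm := hg.1
  rw [← lintegral_add_left (by fun_prop)]
  refine lintegral_mono fun x => ?_
  refine le_trans ?_ (min_add_le _ _)
  exact min_le_min_right _ (enorm_add_le _ _)

lemma PInt.const_mul {μ : Measure E} {g : E → ℝ} (hg : PInt μ g) (c : ℝ) :
    PInt μ (fun x => c * g x) := by
  refine ⟨hg.1.const_mul c, ne_top_of_le_ne_top
    (ENNReal.mul_ne_top (a := max ‖c‖ₑ 1) (by simp) hg.2) ?_⟩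
  have hm := hg.1
  rw [← lintegral_const_mul _ (by fun_prop)]
  refine lintegral_mono fun x => ?_
  rw [enorm_mul]
  rcases le_total ‖g x‖ₑ 1 with h | h
  · rw [min_eq_left h]
    exact (min_le_left _ _).trans (mul_le_mul_left (le_max_left _ _) _)
  · rw [min_eq_right h, mul_one]
    exact (min_le_right _ _).trans (le_max_right _ _)

lemma PInt.sum {μ : Measure E} {ι : Type} (s : Finset ι) (g : ι → E → ℝ)
    (hg : ∀ i, PInt μ (g i)) : PInt μ (fun x => ∑ i ∈ s, g i x) := by
  classical
  induction s using Finset.induction_on with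
  | empty => exact ⟨by simp, by simp⟩
  | insert a s ha ih =>
    simp_rw [Finset.sum_insert ha]
    exact (hg a).add ih

lemma PInt.integrable {μ : Measure E} {g : E → ℝ} (hg : PInt μ g) :
    Integrable (fun x => Complex.exp (Complex.I * g x) - 1) μ := by
  have hm := hg.1
  refine ⟨(by fun_prop : Measurable _).aestronglyMeasurable, ?_⟩
  rw [HasFiniteIntegral]
  refine lt_of_le_of_lt (b := ∫⁻ x, 2 * min ‖g x‖ₑ 1 ∂μ) (lintegral_mono fun x => ?_) ?_
  · rcases le_total ‖g x‖ₑ 1 with h | h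
    · rw [min_eq_left h]
      refine Real.enorm_exp_I_mul_ofReal_sub_one_le.trans ?_
      exact le_mul_of_one_le_left' (by norm_num)
    · rw [min_eq_right h, mul_one]
      refine (enorm_sub_le).trans ?_
      have : ‖Complex.exp (Complex.I * g x)‖ₑ = 1 := by
        rw [← ofReal_norm, mul_comm, Complex.norm_exp_ofReal_mul_I]; simp
      rw [this, enorm_one, one_add_one_eq_two]
  · rw [lintegral_const_mul _ (by fun_prop)]
    exact ENNReal.mul_lt_top (by simp) hg.2.lt_top

lemma exists_normalize [Inhabited E] (m : Measure E) [IsFiniteMeasure m] :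
    ∃ (r : NNReal) (ν : Measure E), IsProbabilityMeasure ν ∧ m = (r : ENNReal) • ν := by
  by_cases h : m = 0
  · exact ⟨0, Measure.dirac default, inferInstance, by simp [h]⟩
  · have h0 : m Set.univ ≠ 0 := by simpa using h
    refine ⟨(m Set.univ).toNNReal, (m Set.univ)⁻¹ • m, ⟨?_⟩, ?_⟩
    · simp [ENNReal.inv_mul_cancel h0 (measure_ne_top _ _)]
    · rw [ENNReal.coe_toNNReal (measure_ne_top _ _), smul_smul,
        ENNReal.mul_inv_cancel h0 (measure_ne_top _ _), one_smul]

/-- Poisson integral -/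
def PX (g : E → ℝ) (ω : ℕ → ℕ × (ℕ → E)) : ℝ := ∑' j, blockSum g (ω j)

/-- The underlying law -/
def PP (r : ℕ → NNReal) (ν : ℕ → Measure E) [∀ j, IsProbabilityMeasure (ν j)] :
    Measure (ℕ → ℕ × (ℕ → E)) := Measure.infinitePi fun j => blockMeas (r j) (ν j)

instance (r : ℕ → NNReal) (ν : ℕ → Measure E) [∀ j, IsProbabilityMeasure (ν j)] :
    IsProbabilityMeasure (PP r ν) := by unfold PP; infer_instance

lemma PX_measurable (g : E → ℝ) (hg : Measurable g) : Measurable (PX g) := by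
  have := blockSum_measurable_real g hg
  unfold PX
  exact Measurable.tsum fun j => by fun_prop

lemma blockSum_min (g : E → ℝ) (q : ℕ × (ℕ → E)) :
    min ‖blockSum g q‖ₑ 1 ≤ blockSum (fun x => min ‖g x‖ₑ 1) q := by
  obtain ⟨n, y⟩ := q
  unfold blockSum
  dsimp only
  induction n with
  | zero => simp
  | succ n ih =>
    rw [Finset.sum_range_succ, Finset.sum_range_succ]
    refine (min_le_min_right _ (enorm_add_le _ _)).trans ((min_add_le _ _).trans ?_)
    gcongr

lemma summable_of_min (s : ℕ → ℝ) (B : ℕ → ENNReal) (h : ∀ j, min ‖s j‖ₑ 1 ≤ B j)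
    (hB : ∑' j, B j ≠ ⊤) : Summable s := by
  have h1 := ENNReal.tendsto_cofinite_zero_of_tsum_ne_top hB
  have h2 : ∀ᶠ j in cofinite, B j < 1 := h1.eventually_lt_const (by simp)
  refine Summable.of_norm_bounded_eventually (ENNReal.summable_toReal hB) ?_
  filter_upwards [h2] with j hj
  have h3 : ‖s j‖ₑ ≤ B j := by
    rcases min_le_iff.1 (h j) with h | h
    · exact h
    · exact absurd hj (not_lt.2 h)
  rw [← toReal_enorm]
  exact ENNReal.toReal_mono (hj.trans ENNReal.one_lt_top).ne h3

lemma PX_summable (r : ℕ → NNReal) (ν : ℕ → Measure E) [∀ j, IsProbabilityMeasure (ν j)]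
    (g : E → ℝ) (hg : PInt (Measure.sum fun j => (r j : ENNReal) • ν j) g) :
    ∀ᵐ ω ∂(PP r ν), Summable fun j => blockSum g (ω j) := by
  have hm := hg.1
  have hB := blockSum_measurable_ennreal (fun x => min ‖g x‖ₑ 1) (by fun_prop)
  have hBj : ∀ j, Measurable fun ω : ℕ → ℕ × (ℕ → E) => blockSum (fun x => min ‖g x‖ₑ 1) (ω j) :=
    fun j => hB.comp (measurable_pi_apply j)
  have h1 : ∫⁻ ω, ∑' j, blockSum (fun x => min ‖g x‖ₑ 1) (ω j) ∂(PP r ν) ≠ ⊤ := by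
    rw [lintegral_tsum (fun j => (hBj j).aemeasurable)]
    have h2 := hg.2
    rw [lintegral_sum_measure] at h2
    convert h2 using 3 with j
    have hp := measurePreserving_eval_infinitePi (fun j => blockMeas (r j) (ν j)) j
    rw [lintegral_smul_measure, smul_eq_mul, ← block_lintegral _ _ _ (by fun_prop)]
    exact hp.lintegral_comp hB
  have h2 := ae_lt_top (Measurable.tsum hBj) h1
  filter_upwards [h2] with ω hω
  exact summable_of_min _ _ (fun j => blockSum_min g (ω j)) hω.ne

lemma PX_sum (r : ℕ → NNReal) (ν : ℕ → Measure E) [∀ j, IsProbabilityMeasure (ν j)]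
    {ι : Type} (s : Finset ι) (g : ι → E → ℝ) (t : ι → ℝ)
    (hg : ∀ i, PInt (Measure.sum fun j => (r j : ENNReal) • ν j) (g i)) :
    ∀ᵐ ω ∂(PP r ν), ∑ i ∈ s, t i * PX (g i) ω = PX (fun x => ∑ i ∈ s, t i * g i x) ω := by
  have h : ∀ᵐ ω ∂(PP r ν), ∀ i ∈ s, Summable fun j => blockSum (g i) (ω j) :=
    (ae_ball_iff s.countable_toSet).2 fun i _ => PX_summable r ν (g i) (hg i)
  filter_upwards [h] with ω hω
  unfold PX
  simp_rw [← tsum_mul_left]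
  rw [← Summable.tsum_finsetSum (fun i hi => (hω i hi).mul_left _)]
  refine tsum_congr fun j => ?_
  unfold blockSum
  rw [Finset.sum_comm]
  simp_rw [Finset.mul_sum]

lemma PX_char (r : ℕ → NNReal) (ν : ℕ → Measure E) [∀ j, IsProbabilityMeasure (ν j)]
    (μ : Measure E) (hμ : μ = Measure.sum fun j => (r j : ENNReal) • ν j)
    (g : E → ℝ) (hg : PInt μ g) :
    ∫ ω, Complex.exp (Complex.I * (PX g ω : ℝ)) ∂(PP r ν) =
      Complex.exp (∫ x, (Complex.exp (Complex.I * g x) - 1) ∂μ) := by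
  have hm := hg.1
  have hB := blockSum_measurable_real g hg.1
  have hs := PX_summable r ν g (hμ ▸ hg)
  have hInt := hg.integrable
  rw [hμ] at hInt
  have hS := hasSum_integral_measure hInt
  rw [← hμ] at hS
  have t1 : Tendsto (fun J : ℕ => ∫ ω, Complex.exp (Complex.I *
      ((∑ j ∈ Finset.range J, blockSum g (ω j) : ℝ) : ℂ)) ∂(PP r ν)) atTop
      (nhds (∫ ω, Complex.exp (Complex.I * (PX g ω : ℝ)) ∂(PP r ν))) := by
    refine tendsto_integral_of_dominated_convergence (fun _ => 1) (fun J => ?_)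
      (integrable_const _) (fun J => ae_of_all _ fun ω => ?_) ?_
    · exact (by fun_prop : Measurable _).aestronglyMeasurable
    · rw [mul_comm, Complex.norm_exp_ofReal_mul_I]
    · filter_upwards [hs] with ω hω
      have h1 := hω.hasSum.tendsto_sum_nat
      have h2 : Continuous fun x : ℝ => Complex.exp (Complex.I * (x : ℂ)) := by fun_prop
      exact (h2.tendsto _).comp h1
  have e : ∀ J : ℕ, ∫ ω, Complex.exp (Complex.I *
      ((∑ j ∈ Finset.range J, blockSum g (ω j) : ℝ) : ℂ)) ∂(PP r ν) =
      Complex.exp (∑ j ∈ Finset.range J,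
        ∫ x, (Complex.exp (Complex.I * g x) - 1) ∂((r j : ENNReal) • ν j)) := by
    intro J
    have h1 := prod_integral (fun j => blockMeas (r j) (ν j))
      (fun _ q => Complex.exp (Complex.I * (blockSum g q : ℝ))) (fun _ => by fun_prop) J
    rw [Complex.exp_sum]
    have h2 : ∀ j, ∫ q, Complex.exp (Complex.I * (blockSum g q : ℝ)) ∂(blockMeas (r j) (ν j)) =
        Complex.exp (∫ x, (Complex.exp (Complex.I * g x) - 1) ∂((r j : ENNReal) • ν j)) := by
      intro j
      rw [block_char _ _ g hm, integral_smul_measure, integral_sub, integral_const]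
      · simp
      · refine Integrable.of_bound (C := 1) ?_ (ae_of_all _ fun q => ?_)
        · exact (by fun_prop : Measurable _).aestronglyMeasurable
        · rw [mul_comm, Complex.norm_exp_ofReal_mul_I]
      · exact integrable_const _
    simp_rw [h2] at h1
    rw [← h1]
    refine integral_congr_ae (ae_of_all _ fun y => ?_)
    dsimp only
    push_cast
    rw [Finset.mul_sum, Complex.exp_sum]
  simp_rw [e] at t1
  refine tendsto_nhds_unique t1 ?_
  exact (Complex.continuous_exp.tendsto _).comp hS.tendsto_sum_nat

lemma map_eq_of_char {Ω : Type} [MeasurableSpace Ω] (P : Measure Ω) [IsProbabilityMeasure P]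
    (Y Z : ℕ → Ω → ℝ) (hY : ∀ n, Measurable (Y n)) (hZ : ∀ n, Measurable (Z n))
    (h : ∀ (s : Finset ℕ) (t : s → ℝ),
      ∫ ω, Complex.exp (Complex.I * ((∑ i, t i * Y i ω : ℝ) : ℂ)) ∂P =
      ∫ ω, Complex.exp (Complex.I * ((∑ i, t i * Z i ω : ℝ) : ℂ)) ∂P) :
    Measure.map (fun ω i => Y i ω) P = Measure.map (fun ω i => Z i ω) P := by
  rw [map_eq_iff_forall_finset_map_restrict_eq (by fun_prop) (by fun_prop)]
  intro s
  have hYs : Measurable (fun ω => s.restrict (Y · ω)) := by fun_prop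
  have hZs : Measurable (fun ω => s.restrict (Z · ω)) := by fun_prop
  have := Measure.isProbabilityMeasure_map (μ := P) hYs.aemeasurable
  have := Measure.isProbabilityMeasure_map (μ := P) hZs.aemeasurable
  refine Measure.ext_of_charFunDual ?_
  ext L
  rw [charFunDual_apply, charFunDual_apply, integral_map hYs.aemeasurable
    (by fun_prop), integral_map hZs.aemeasurable (by fun_prop)]
  have hL : ∀ x : s → ℝ, L x = ∑ i, L (fun j => if i = j then 1 else 0) * x i := by
    intro x
    have := LinearMap.pi_apply_eq_sum_univ (L : (s → ℝ) →ₗ[ℝ] ℝ) x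
    simpa [mul_comm] using this
  have := h s (fun i => L (fun j => if i = j then 1 else 0))
  simp_rw [mul_comm _ Complex.I]
  convert this using 4 with ω ω
  · rw [hL]; rfl
  · rw [hL]; rfl

/-- Two families of Poisson integrals related by a measure preserving map have the same law. -/
lemma PX_map_eq (r : ℕ → NNReal) (ν : ℕ → Measure E) [∀ j, IsProbabilityMeasure (ν j)]
    (μ : Measure E) (hμ : μ = Measure.sum fun j => (r j : ENNReal) • ν j)
    (f g : ℕ → E → ℝ) (hf : ∀ n, PInt μ (f n)) (hg : ∀ n, PInt μ (g n))
    (T : E → E) (hT : MeasurePreserving T μ μ) (hfg : ∀ n x, g n x = f n (T x)) :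
    Measure.map (fun ω i => PX (f i) ω) (PP r ν) =
      Measure.map (fun ω i => PX (g i) ω) (PP r ν) := by
  refine map_eq_of_char _ _ _ (fun n => PX_measurable _ (hf n).1)
    (fun n => PX_measurable _ (hg n).1) fun s t => ?_
  have key : ∀ u : ℕ → E → ℝ, (∀ n, PInt μ (u n)) →
      ∫ ω, Complex.exp (Complex.I * ((∑ i, t i * PX (u i) ω : ℝ) : ℂ)) ∂(PP r ν) =
      Complex.exp (∫ x, (Complex.exp (Complex.I * ((∑ i, t i * u i x : ℝ) : ℂ)) - 1) ∂μ) := by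
    intro u hu
    rw [← PX_char r ν μ hμ _ (PInt.sum Finset.univ (fun (i : s) x => t i * u i x)
      fun i => (hu i).const_mul (t i))]
    refine integral_congr_ae ?_
    filter_upwards [PX_sum r ν Finset.univ (fun i : s => u i) t (fun i => hμ ▸ hu i)] with ω hω
    rw [hω]
  rw [key f hf, key g hg]
  congr 1
  simp_rw [hfg]
  have hm : ∀ n, Measurable (f n) := fun n => (hf n).1
  conv_lhs => rw [← hT.map_eq]
  rw [integral_map hT.measurable.aemeasurable]
  exact (by fun_prop : Measurable _).aestronglyMeasurable

lemma PX_nontrivial (r : ℕ → NNReal) (ν : ℕ → Measure E) [∀ j, IsProbabilityMeasure (ν j)]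
    (μ : Measure E) (hμ : μ = Measure.sum fun j => (r j : ENNReal) • ν j)
    (g : E → ℝ) (hg : PInt μ g) (A : Set E) (hA : μ A ≠ 0)
    (hgA : ∀ x ∈ A, Real.cos (g x) ≠ 1) (c : ℝ) :
    Measure.map (PX g) (PP r ν) ≠ Measure.dirac c := by
  intro h
  have h1 := PX_char r ν μ hμ g hg
  have h2 : ∫ ω, Complex.exp (Complex.I * (PX g ω : ℝ)) ∂(PP r ν) =
      Complex.exp (Complex.I * c) := by
    have hm : Measurable fun y : ℝ => Complex.exp (Complex.I * y) := by fun_prop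
    have := integral_map (μ := PP r ν) (PX_measurable g hg.1).aemeasurable
      (f := fun y : ℝ => Complex.exp (Complex.I * y)) hm.aestronglyMeasurable
    rw [← this, h, integral_dirac]
  have h3 := congrArg (fun z : ℂ => ‖z‖) (h1.symm.trans h2)
  rw [mul_comm, Complex.norm_exp_ofReal_mul_I, Complex.norm_exp, Real.exp_eq_one_iff] at h3
  have hre : ∀ x, (Complex.exp (Complex.I * g x) - 1).re = Real.cos (g x) - 1 := by
    intro x
    rw [mul_comm, Complex.sub_re, Complex.exp_ofReal_mul_I_re, Complex.one_re]
  have hInt := hg.integrable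
  have h4 : ∫ x, (1 - Real.cos (g x)) ∂μ = 0 := by
    have h5 := integral_re hInt
    simp only [RCLike.re_to_complex, hre] at h5
    rw [h3] at h5
    rw [← neg_eq_zero, ← integral_neg, ← h5]
    simp
  have hInt2 : Integrable (fun x => 1 - Real.cos (g x)) μ := by
    have := hInt.re.neg
    refine this.congr (ae_of_all _ fun x => ?_)
    simp only [Pi.neg_apply, RCLike.re_to_complex, hre]
    ring
  rw [integral_eq_zero_iff_of_nonneg (fun x => by simpa using Real.cos_le_one (g x)) hInt2] at h4
  apply hA
  refine measure_mono_null ?_ (ae_iff.1 h4)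
  intro x hx h6
  refine hgA x hx ?_
  simp only [Pi.zero_apply] at h6
  linarith

end Poisson

/-! Part 3: the power case. -/

/-- indicator of a window of length `1 / w` to the left of `a` -/
def win (a x w : ℝ) : ℝ := if x ≤ a ∧ (a - x) * w < 1 then 1 else 0

/-- the kernel -/
def pker (H : ℝ) (n : ℕ) (z : ℝ × ℝ) : ℝ :=
  if 0 < z.2 then z.2 ^ (-H) * (win n z.1 z.2 - win 0 z.1 z.2) else 0

lemma ker_measurable (H : ℝ) (n : ℕ) : Measurable (pker H n) := by
  have hw : ∀ a : ℝ, Measurable fun z : ℝ × ℝ => win a z.1 z.2 := by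
    intro a
    unfold win
    refine Measurable.ite ?_ measurable_const measurable_const
    have h1 : MeasurableSet {z : ℝ × ℝ | z.1 ≤ a} :=
      measurableSet_le measurable_fst measurable_const
    have h2 : MeasurableSet {z : ℝ × ℝ | (a - z.1) * z.2 < 1} :=
      measurableSet_lt (by fun_prop) measurable_const
    exact h1.inter h2
  unfold pker
  refine Measurable.ite (measurableSet_lt (by fun_prop) (by fun_prop)) ?_ measurable_const
  exact (measurable_snd.pow_const _).mul ((hw _).sub (hw _))

lemma win_eq (a x w : ℝ) (hw : 0 < w) :
    win a x w = (Set.Ioc (a - 1 / w) a).indicator (fun _ => (1 : ℝ)) x := by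
  have : (x ≤ a ∧ (a - x) * w < 1) ↔ x ∈ Set.Ioc (a - 1 / w) a := by
    rw [← lt_div_iff₀ hw, Set.mem_Ioc, and_comm]
    constructor <;> rintro ⟨h1, h2⟩ <;> exact ⟨by linarith, h2⟩
  by_cases h : x ∈ Set.Ioc (a - 1 / w) a
  · rw [Set.indicator_of_mem h, win, if_pos (this.2 h)]
  · rw [Set.indicator_of_notMem h, win, if_neg (fun h' => h (this.1 h'))]

lemma enorm_ind (s : Set ℝ) (x : ℝ) :
    ‖s.indicator (fun _ => (1 : ℝ)) x‖ₑ = s.indicator (fun _ => (1 : ENNReal)) x := by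
  by_cases h : x ∈ s <;> simp [h]

lemma lint_ind (a c : ℝ) :
    ∫⁻ x, (Set.Ioc a c).indicator (fun _ => (1 : ENNReal)) x = ENNReal.ofReal (c - a) := by
  rw [lintegral_indicator measurableSet_Ioc]
  simp

lemma ker_inner_small (H : ℝ) (n : ℕ) (w : ℝ) (hw : 0 < w) :
    ∫⁻ x, min ‖pker H n (x, w)‖ₑ 1 ≤ ENNReal.ofReal n + ENNReal.ofReal n := by
  have h : ∀ x, min ‖pker H n (x, w)‖ₑ 1 ≤
      (Set.Ioc (0 : ℝ) n).indicator (fun _ => (1 : ENNReal)) x +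
      (Set.Ioc (0 - 1 / w) (n - 1 / w)).indicator (fun _ => (1 : ENNReal)) x := by
    intro x
    by_cases h1 : x ∈ Set.Ioc (0 : ℝ) n
    · rw [Set.indicator_of_mem h1]
      exact (min_le_right _ _).trans le_self_add
    by_cases h2 : x ∈ Set.Ioc (0 - 1 / w) (n - 1 / w)
    · rw [Set.indicator_of_mem h2]
      exact (min_le_right _ _).trans le_add_self
    have : pker H n (x, w) = 0 := by
      have hn : (0 : ℝ) ≤ n := n.cast_nonneg
      simp only [pker, hw, if_true, win_eq _ _ _ hw]
      have : x ∈ Set.Ioc ((n : ℝ) - 1 / w) n ↔ x ∈ Set.Ioc ((0 : ℝ) - 1 / w) 0 := by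
        simp only [Set.mem_Ioc, not_and_or, not_lt, not_le] at h1 h2 ⊢
        constructor
        · rintro ⟨h3, h4⟩
          refine ⟨by linarith, ?_⟩
          rcases h1 with h1 | h1 <;> linarith
        · rintro ⟨h3, h4⟩
          refine ⟨?_, by linarith⟩
          rcases h2 with h2 | h2 <;> linarith
      by_cases h3 : x ∈ Set.Ioc ((n : ℝ) - 1 / w) n
      · rw [Set.indicator_of_mem h3, Set.indicator_of_mem (this.1 h3)]; simp
      · rw [Set.indicator_of_notMem h3, Set.indicator_of_notMem (fun h => h3 (this.2 h))]; simp
    simp [this]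
  refine (lintegral_mono h).trans ?_
  rw [lintegral_add_left (measurable_const.indicator measurableSet_Ioc), lint_ind, lint_ind]
  simp

lemma ker_inner_large (H : ℝ) (n : ℕ) (w : ℝ) (hw : 0 < w) :
    ∫⁻ x, min ‖pker H n (x, w)‖ₑ 1 ≤ 2 * ENNReal.ofReal (w ^ (-H - 1)) := by
  have h : ∀ x, min ‖pker H n (x, w)‖ₑ 1 ≤ ENNReal.ofReal (w ^ (-H)) * (
      (Set.Ioc ((n : ℝ) - 1 / w) n).indicator (fun _ => (1 : ENNReal)) x +
      (Set.Ioc (0 - 1 / w) 0).indicator (fun _ => (1 : ENNReal)) x) := by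
    intro x
    refine (min_le_left _ _).trans ?_
    simp only [pker, hw, if_true, win_eq _ _ _ hw]
    rw [enorm_mul, Real.enorm_eq_ofReal (by positivity)]
    gcongr
    refine enorm_sub_le.trans ?_
    rw [enorm_ind, enorm_ind]
  refine (lintegral_mono h).trans ?_
  have hm : ∀ a c : ℝ, Measurable ((Set.Ioc a c).indicator (fun _ => (1 : ENNReal))) :=
    fun a c => measurable_const.indicator measurableSet_Ioc
  rw [lintegral_const_mul _ ((hm _ _).fun_add (hm _ _)), lintegral_add_left (hm _ _),
    lint_ind, lint_ind, Real.rpow_sub_one hw.ne', div_eq_mul_inv (w ^ (-H)) w,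
    ENNReal.ofReal_mul (by positivity)]
  apply le_of_eq
  rw [sub_sub_cancel, sub_sub_cancel, one_div, ← two_mul]
  ring

lemma ker_PInt (H : ℝ) (hH : 0 < H) (n : ℕ) : PInt (volume : Measure (ℝ × ℝ)) (pker H n) := by
  have hk := ker_measurable H n
  refine ⟨hk, ?_⟩
  rw [Measure.volume_eq_prod, lintegral_prod_symm _ (by fun_prop)]
  have hb : ∀ w : ℝ, ∫⁻ x, min ‖pker H n (x, w)‖ₑ 1 ≤
      (Set.Ioc (0 : ℝ) 1).indicator (fun _ => ENNReal.ofReal n + ENNReal.ofReal n) w +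
      (Set.Ioi (1 : ℝ)).indicator (fun w => 2 * ENNReal.ofReal (w ^ (-H - 1))) w := by
    intro w
    rcases le_or_gt w 0 with hw | hw
    · have : ∀ x, pker H n (x, w) = 0 := fun x => if_neg (not_lt.2 hw)
      simp [this]
    rcases le_or_gt w 1 with hw1 | hw1
    · rw [Set.indicator_of_mem (Set.mem_Ioc.2 ⟨hw, hw1⟩)]
      exact (ker_inner_small H n w hw).trans le_self_add
    · rw [Set.indicator_of_mem (Set.mem_Ioi.2 hw1)]
      exact (ker_inner_large H n w hw).trans le_add_self
  refine ne_top_of_le_ne_top ?_ (lintegral_mono hb)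
  rw [lintegral_add_left (measurable_const.indicator measurableSet_Ioc),
    lintegral_indicator measurableSet_Ioc, lintegral_indicator measurableSet_Ioi]
  refine ENNReal.add_ne_top.2 ⟨by simp, ?_⟩
  rw [lintegral_const_mul _ (by fun_prop)]
  refine ENNReal.mul_ne_top (by simp) ?_
  have := integrableOn_Ioi_rpow_of_lt (a := -H - 1) (by linarith) one_pos
  exact (Integrable.lintegral_lt_top this).ne

lemma ker_scale_mp (n : ℕ) (hn : 1 ≤ n) : MeasurePreserving
    (fun z : ℝ × ℝ => ((n : ℝ)⁻¹ * z.1, (n : ℝ) * z.2)) volume volume := by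
  have hn0 : (0 : ℝ) < n := by exact_mod_cast hn
  refine ⟨by fun_prop, ?_⟩
  have := Measure.map_prod_map (volume : Measure ℝ) (volume : Measure ℝ)
    (f := fun x => (n : ℝ)⁻¹ * x) (g := fun x => (n : ℝ) * x) (by fun_prop) (by fun_prop)
  rw [Real.map_volume_mul_left (inv_ne_zero hn0.ne'), Real.map_volume_mul_left hn0.ne',
    Measure.prod_smul_left, Measure.prod_smul_right, smul_smul,
    ← ENNReal.ofReal_mul (by positivity), inv_inv, abs_of_pos hn0,
    abs_of_pos (inv_pos.2 hn0), mul_inv_cancel₀ hn0.ne', ENNReal.ofReal_one, one_smul] at this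
  exact this.symm

lemma ker_scale (H : ℝ) (n m : ℕ) (hn : 1 ≤ n) (z : ℝ × ℝ) :
    pker H (n * m) z = (n : ℝ) ^ H * pker H m ((n : ℝ)⁻¹ * z.1, (n : ℝ) * z.2) := by
  have hn0 : (0 : ℝ) < n := by exact_mod_cast hn
  obtain ⟨x, w⟩ := z
  unfold pker
  dsimp only
  by_cases hw : 0 < w
  · have hnw : 0 < (n : ℝ) * w := by positivity
    rw [if_pos hw, if_pos hnw, Real.mul_rpow hn0.le hw.le, Real.rpow_neg hn0.le]
    have key : ∀ a : ℝ, win (n * a) x w = win a ((n : ℝ)⁻¹ * x) (n * w) := by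
      intro a
      unfold win
      have e1 : x ≤ n * a ↔ (n : ℝ)⁻¹ * x ≤ a := by
        rw [inv_mul_le_iff₀ hn0]
      have e2 : (n * a - x) * w = (a - (n : ℝ)⁻¹ * x) * (n * w) := by
        field_simp
      simp only [e1, e2]
    have k0 := key 0
    rw [mul_zero] at k0
    push_cast
    rw [key, k0]
    have : (n : ℝ) ^ H ≠ 0 := (Real.rpow_pos_of_pos hn0 _).ne'
    field_simp
  · have hnw : ¬ 0 < (n : ℝ) * w := by
      rw [mul_pos_iff_of_pos_left hn0]; exact hw
    rw [if_neg hw, if_neg hnw, mul_zero]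

lemma ker_shift (H : ℝ) (k m : ℕ) (z : ℝ × ℝ) :
    pker H (m + k) z - pker H k z = pker H m (z.1 - k, z.2) := by
  obtain ⟨x, w⟩ := z
  have key : ∀ a : ℝ, win (a + k) x w = win a (x - k) w := by
    intro a
    unfold win
    have e1 : x ≤ a + k ↔ x - k ≤ a := by rw [sub_le_iff_le_add]
    have e2 : (a + k - x) * w = (a - (x - k)) * w := by ring
    simp only [e1, e2]
  have k0 := key 0
  rw [zero_add] at k0
  unfold pker
  dsimp only
  push_cast
  split_ifs
  · rw [key, ← k0]; ring
  · simp

lemma ker_shift_mp (k : ℕ) : MeasurePreserving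
    (fun z : ℝ × ℝ => (z.1 - k, z.2)) volume volume := by
  rw [Measure.volume_eq_prod]
  exact (measurePreserving_sub_right (volume : Measure ℝ) (k : ℝ)).prod
    (MeasurePreserving.id volume)

lemma ker_cos (H : ℝ) (hH : 0 < H) (z : ℝ × ℝ)
    (hz : z ∈ Set.Ioo (1 / 2 : ℝ) 1 ×ˢ Set.Ioo (1 : ℝ) 2) : Real.cos (pker H 1 z) ≠ 1 := by
  obtain ⟨x, w⟩ := z
  obtain ⟨⟨h1, h2⟩, h3, h4⟩ := hz
  dsimp only at h1 h2 h3 h4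
  have hw : 0 < w := by linarith
  have e1 : win 1 x w = 1 := if_pos ⟨h2.le, by nlinarith⟩
  have e0 : win 0 x w = 0 := if_neg (fun h => by linarith [h.1])
  have : pker H 1 (x, w) = w ^ (-H) := by
    unfold pker
    dsimp only
    rw [if_pos hw, Nat.cast_one, e1, e0]
    ring
  rw [this]
  have p1 : 0 < w ^ (-H) := by positivity
  have p2 : w ^ (-H) < 1 := Real.rpow_lt_one_of_one_lt_of_neg h3 (by linarith)
  intro hc
  rw [Real.cos_eq_one_iff_of_lt_of_lt (by linarith [Real.pi_gt_three])
    (by linarith [Real.pi_gt_three])] at hc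
  linarith

lemma case_three (b : ℕ → ℝ) (H : ℝ) (hH : 0 < H)
    (h : ∀ n : ℕ, 1 ≤ n → b n = (n : ℝ) ^ H) :
    ∃ (Ω : Type) (_ : MeasurableSpace Ω) (P : Measure Ω),
      IsProbabilityMeasure P ∧
      ∃ X : ℕ → Ω → ℝ, (∀ n, Measurable (X n)) ∧
        SelfSimilar P X b ∧ StationaryIncrements P X ∧
        ∀ c : ℝ, Measure.map (X 1) P ≠ Measure.dirac c := by
  choose r ν hν hm using fun j => exists_normalize (sfiniteSeq (volume : Measure (ℝ × ℝ)) j)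
  have hμ : (volume : Measure (ℝ × ℝ)) = Measure.sum fun j => (r j : ENNReal) • ν j := by
    simp_rw [← hm]
    exact (sum_sfiniteSeq _).symm
  have hker := ker_PInt H hH
  have hX : ∀ n, Measurable (PX (pker H n)) := fun n => PX_measurable _ (hker n).1
  refine ⟨ℕ → ℕ × (ℕ → ℝ × ℝ), inferInstance, PP r ν, inferInstance, fun n => PX (pker H n),
    hX, ?_, ?_, ?_⟩
  · intro n hn
    unfold EqDistFam
    have e : (fun ω m => b n * PX (pker H m) ω) =
        fun (ω : ℕ → ℕ × (ℕ → ℝ × ℝ)) m => PX (fun z => (n : ℝ) ^ H * pker H m z) ω := by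
      ext ω m
      rw [h n hn]
      unfold PX blockSum
      rw [← tsum_mul_left]
      simp_rw [Finset.mul_sum]
    rw [e]
    exact (PX_map_eq r ν _ hμ (fun m z => (n : ℝ) ^ H * pker H m z) (fun m => pker H (n * m))
      (fun m => (hker m).const_mul _) (fun m => hker _) _ (ker_scale_mp n hn)
      (fun m z => ker_scale H n m hn z)).symm
  · intro k hk
    unfold EqDistFam
    have hsub : ∀ i j, PInt volume fun z => pker H i z - pker H j z := by
      intro i j
      have := (hker i).add ((hker j).const_mul (-1))
      simpa [sub_eq_add_neg] using this
    have hae : ∀ i j, (fun ω => PX (pker H i) ω - PX (pker H j) ω) =ᵐ[PP r ν]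
        PX fun z => pker H i z - pker H j z := by
      intro i j
      filter_upwards [PX_summable r ν _ (hμ ▸ hker i), PX_summable r ν _ (hμ ▸ hker j)]
        with ω h1 h2
      unfold PX
      rw [← h1.tsum_sub h2]
      unfold blockSum
      simp_rw [Finset.sum_sub_distrib]
    have hmap : ∀ u v : ℕ → ℕ, Measure.map (fun ω m => PX (pker H (u m)) ω - PX (pker H (v m)) ω)
        (PP r ν) = Measure.map (fun ω m => PX (fun z => pker H (u m) z - pker H (v m) z) ω)
        (PP r ν) := by
      intro u v
      refine Measure.map_congr ?_
      have := ae_all_iff.2 fun m => hae (u m) (v m)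
      filter_upwards [this] with ω hω
      exact funext hω
    have h1 := hmap (fun m => m + 1) (fun m => m)
    have h2 := hmap (fun m => m + k + 1) (fun m => m + k)
    refine h1.trans (Eq.trans ?_ h2.symm)
    refine PX_map_eq r ν _ hμ (fun m z => pker H (m + 1) z - pker H m z)
      (fun m z => pker H (m + k + 1) z - pker H (m + k) z) (fun m => hsub _ _)
      (fun m => hsub _ _) _ (ker_shift_mp k) fun m z => ?_
    rw [← ker_shift, ← ker_shift, add_right_comm]
    ring
  · refine PX_nontrivial r ν _ hμ _ (hker 1) (Set.Ioo (1 / 2 : ℝ) 1 ×ˢ Set.Ioo (1 : ℝ) 2) ?_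
      (ker_cos H hH)
    rw [Measure.volume_eq_prod, Measure.prod_prod, Real.volume_Ioo, Real.volume_Ioo]
    norm_num

/-- Converse part of the classification theorem: every completely multiplicative scaling
function of one of the three types is the scaling function of some non-trivial dt-ss-si
process. -/
theorem stmt1 (b : ℕ → ℝ) (hbpos : ∀ n : ℕ, 1 ≤ n → 0 < b n)
    (hmul : ∀ m n : ℕ, 1 ≤ m → 1 ≤ n → b (m * n) = b m * b n)
    (hcase :
      (∀ n : ℕ, 1 ≤ n → b n = 1) ∨
      (∃ p : ℕ, p.Prime ∧ ∃ H : ℝ, 0 < H ∧ ∀ n : ℕ, 1 ≤ n → b n = (padicNormNat p n) ^ H) ∨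
      (∃ H : ℝ, 0 < H ∧ ∀ n : ℕ, 1 ≤ n → b n = (n : ℝ) ^ H)) :
    ∃ (Ω : Type) (_ : MeasurableSpace Ω) (P : Measure Ω),
      IsProbabilityMeasure P ∧
      ∃ X : ℕ → Ω → ℝ, (∀ n, Measurable (X n)) ∧
        SelfSimilar P X b ∧ StationaryIncrements P X ∧
        ∀ c : ℝ, Measure.map (X 1) P ≠ Measure.dirac c := by
  rcases hcase with h | ⟨p, hp, H, hH, h⟩ | ⟨H, hH, h⟩
  · exact case_one b h
  · exact case_two b p hp H hH h
  · exact case_three b H hH h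
end
end

section
/- Let H > 0 and let X = (X_n)_{n∈ℕ₀} be a dt-ss-si process with scaling function b(n) = n^H. Then there exist a probability space and a family of real random variables Y = (Y(t))_{t∈[0,∞)} on it such that: (i) for every a > 0, (Y(at))_{t≥0} ≐ (a^H·Y(t))_{t≥0}; (ii) for every h ≥ 0, (Y(t+h) − Y(h))_{t≥0} ≐ (Y(t) − Y(0))_{t≥0}; and (iii) (Y(n))_{n∈ℕ₀} ≐ (X_n)_{n∈ℕ₀}. Moreover, any two families satisfying (i), (ii) and (iii) have the same finite-dimensional distributions. -/
open MeasureTheory ProbabilityTheory Filter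

noncomputable section

namespace DtSs

set_option linter.unusedSectionVars false

open Topology

section basics

variable {ι κ Ω₁ Ω₂ : Type*} [MeasurableSpace Ω₁] [MeasurableSpace Ω₂]
  {P₁ : Measure Ω₁} {P₂ : Measure Ω₂}

lemma eqDist_comp {X : ι → Ω₁ → ℝ} {Y : ι → Ω₂ → ℝ} (h : EqDistFam P₁ P₂ X Y)
    (hX : ∀ i, Measurable (X i)) (hY : ∀ i, Measurable (Y i))
    {β : Type*} [MeasurableSpace β] (g : (ι → ℝ) → β) (hg : Measurable g) :
    Measure.map (fun ω => g (fun i => X i ω)) P₁ = Measure.map (fun ω => g (fun i => Y i ω)) P₂ := by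
  have h1 := congrArg (Measure.map g) h
  rwa [Measure.map_map hg (measurable_pi_lambda _ hX),
    Measure.map_map hg (measurable_pi_lambda _ hY)] at h1

lemma eqDist_integral {X : ι → Ω₁ → ℝ} {Y : ι → Ω₂ → ℝ} (h : EqDistFam P₁ P₂ X Y)
    (hX : ∀ i, Measurable (X i)) (hY : ∀ i, Measurable (Y i))
    (F : (ι → ℝ) → ℝ) (hF : Measurable F) :
    ∫ ω, F (fun i => X i ω) ∂P₁ = ∫ ω, F (fun i => Y i ω) ∂P₂ := by
  have h1 : ∫ x, F x ∂(Measure.map (fun ω i => X i ω) P₁)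
      = ∫ x, F x ∂(Measure.map (fun ω i => Y i ω) P₂) := by
    unfold EqDistFam at h; rw [h]
  rwa [integral_map (measurable_pi_lambda _ hX).aemeasurable hF.aestronglyMeasurable,
    integral_map (measurable_pi_lambda _ hY).aemeasurable hF.aestronglyMeasurable] at h1

lemma map_eq_of_integral [Finite ι] [IsProbabilityMeasure P₁] [IsProbabilityMeasure P₂]
    {X : ι → Ω₁ → ℝ} {Y : ι → Ω₂ → ℝ}
    (hX : ∀ i, Measurable (X i)) (hY : ∀ i, Measurable (Y i))
    (h : ∀ f : BoundedContinuousFunction (ι → ℝ) ℝ,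
      ∫ ω, f (fun i => X i ω) ∂P₁ = ∫ ω, f (fun i => Y i ω) ∂P₂) :
    Measure.map (fun ω i => X i ω) P₁ = Measure.map (fun ω i => Y i ω) P₂ := by
  have mX : Measurable (fun ω i => X i ω) := measurable_pi_lambda _ hX
  have mY : Measurable (fun ω i => Y i ω) := measurable_pi_lambda _ hY
  have := Measure.isProbabilityMeasure_map (μ := P₁) mX.aemeasurable
  have := Measure.isProbabilityMeasure_map (μ := P₂) mY.aemeasurable
  refine ext_of_forall_integral_eq_of_IsFiniteMeasure fun f => ?_
  rw [integral_map mX.aemeasurable f.continuous.measurable.aestronglyMeasurable,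
    integral_map mY.aemeasurable f.continuous.measurable.aestronglyMeasurable]
  exact h f

lemma eqDist_of_integral [IsProbabilityMeasure P₁] [IsProbabilityMeasure P₂]
    {X : ι → Ω₁ → ℝ} {Y : ι → Ω₂ → ℝ}
    (hX : ∀ i, Measurable (X i)) (hY : ∀ i, Measurable (Y i))
    (h : ∀ (I : Finset ι) (f : BoundedContinuousFunction (I → ℝ) ℝ),
      ∫ ω, f (fun i => X i ω) ∂P₁ = ∫ ω, f (fun i => Y i ω) ∂P₂) :
    EqDistFam P₁ P₂ X Y := by
  have mX : Measurable (fun ω i => X i ω) := measurable_pi_lambda _ hX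
  have mY : Measurable (fun ω i => Y i ω) := measurable_pi_lambda _ hY
  have := Measure.isProbabilityMeasure_map (μ := P₁) mX.aemeasurable
  have := Measure.isProbabilityMeasure_map (μ := P₂) mY.aemeasurable
  have key : ∀ I : Finset ι, (Measure.map (fun ω i => X i ω) P₁).map I.restrict
      = (Measure.map (fun ω i => Y i ω) P₂).map I.restrict := by
    intro I
    rw [Measure.map_map (Finset.measurable_restrict I) mX,
      Measure.map_map (Finset.measurable_restrict I) mY]
    exact map_eq_of_integral (X := fun i : I => X i) (Y := fun i : I => Y i)
      (fun i => hX i) (fun i => hY i) (h I)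
  have : ∀ I : Finset ι, IsFiniteMeasure
      ((Measure.map (fun ω i => Y i ω) P₂).map I.restrict) := fun I => inferInstance
  exact IsProjectiveLimit.unique
    (P := fun I : Finset ι => (Measure.map (fun ω i => Y i ω) P₂).map I.restrict)
    (fun I => key I) (fun I => rfl)

end basics

/-- The modulus `E min(1, |δ|^H |Z|)`. -/
def Gf {Ω : Type*} [MeasurableSpace Ω] (P : Measure Ω) (Z : Ω → ℝ) (H δ : ℝ) : ℝ :=
  ∫ ω, min 1 (|δ| ^ H * |Z ω|) ∂P

section Gf

variable {Ω : Type*} [MeasurableSpace Ω] {P : Measure Ω} [IsProbabilityMeasure P]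
  {Z : Ω → ℝ} {H : ℝ}

lemma norm_min_one_le {x : ℝ} (hx : 0 ≤ x) : ‖min 1 x‖ ≤ 1 := by
  rw [Real.norm_eq_abs, abs_of_nonneg (le_min zero_le_one hx)]
  exact min_le_left _ _

lemma integrable_min_one {f : Ω → ℝ} (hf : Measurable f) (h0 : ∀ ω, 0 ≤ f ω) :
    Integrable (fun ω => min 1 (f ω)) P :=
  Integrable.of_bound (measurable_const.min hf).aestronglyMeasurable 1
    (Eventually.of_forall fun ω => norm_min_one_le (h0 ω))

lemma Gf_continuous (hZ : Measurable Z) (hH : 0 < H) : Continuous (Gf P Z H) := by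
  unfold Gf
  refine continuous_of_dominated (bound := fun _ => 1) ?_ ?_ (integrable_const _) ?_
  · intro δ
    exact Measurable.aestronglyMeasurable (by fun_prop)
  · intro δ
    exact Eventually.of_forall fun ω => norm_min_one_le (by positivity)
  · refine Eventually.of_forall fun ω => ?_
    refine continuous_const.min (Continuous.mul ?_ continuous_const)
    exact (continuous_abs).rpow_const fun x => Or.inr hH.le

lemma Gf_zero (hH : 0 < H) : Gf P Z H 0 = 0 := by
  simp [Gf, Real.zero_rpow hH.ne']

lemma Gf_mono (hZ : Measurable Z) (hH : 0 < H) {a b : ℝ} (h : |a| ≤ |b|) :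
    Gf P Z H a ≤ Gf P Z H b := by
  refine integral_mono (integrable_min_one (by fun_prop) fun ω => by positivity)
    (integrable_min_one (by fun_prop) fun ω => by positivity) fun ω => ?_
  dsimp only
  gcongr

lemma Gf_abs (a : ℝ) : Gf P Z H |a| = Gf P Z H a := by simp [Gf]

lemma Gf_neg (a : ℝ) : Gf P Z H (-a) = Gf P Z H a := by simp [Gf]

lemma ae_zero_of_min {f : Ω → ℝ} (hf : Measurable f) (h : ∫ ω, min 1 |f ω| ∂P = 0) :
    ∀ᵐ ω ∂P, f ω = 0 := by
  rw [integral_eq_zero_iff_of_nonneg (fun ω => le_min zero_le_one (abs_nonneg _))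
    (integrable_min_one hf.abs fun ω => abs_nonneg _)] at h
  filter_upwards [h] with ω hω
  rcases min_choice 1 |f ω| with h1 | h1
  · simp [h1] at hω
  · simpa [h1] using hω

end Gf

/-- Standing facts on the discrete process. -/
structure Disc {Ω : Type*} [MeasurableSpace Ω] (P : Measure Ω) (X : ℕ → Ω → ℝ) (H : ℝ) : Prop where
  meas : ∀ n, Measurable (X n)
  Hpos : 0 < H
  zero : ∀ᵐ ω ∂P, X 0 ω = 0
  ss : ∀ n : ℕ, 1 ≤ n → EqDistFam P P (fun m ω => X (n * m) ω) (fun m ω => (n : ℝ) ^ H * X m ω)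
  si : ∀ k : ℕ, EqDistFam P P (fun m ω => X (m + k) ω - X k ω) (fun m ω => X m ω - X 0 ω)

section Disc

variable {Ω : Type*} [MeasurableSpace Ω] {P : Measure Ω} [IsProbabilityMeasure P]
  {X : ℕ → Ω → ℝ} {H : ℝ}

lemma disc_of (hXmeas : ∀ n, Measurable (X n)) (hH : 0 < H)
    (hss : SelfSimilar P X (fun n => (n : ℝ) ^ H))
    (hsi : StationaryIncrements P X) : Disc P X H := by
  refine ⟨hXmeas, hH, ?_, hss, ?_⟩
  · apply ae_zero_of_min (hXmeas 0)
    have h1 : ∀ n : ℕ, Gf P (X 0) H (((n + 1 : ℕ) : ℝ)⁻¹) = ∫ ω, min 1 |X 0 ω| ∂P := by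
      intro n
      have := eqDist_integral (hss (n + 1) (by omega)) (fun m => hXmeas _)
        (fun m => (hXmeas _).const_mul _)
        (fun x => min 1 (|((n + 1 : ℕ) : ℝ)⁻¹| ^ H * |x 0|)) (by fun_prop)
      simp only [mul_zero] at this
      rw [Gf, this]
      congr 1
      ext ω
      have hp : (0 : ℝ) < ((n + 1 : ℕ) : ℝ) := by positivity
      rw [abs_mul, abs_of_pos (inv_pos.2 hp), abs_of_pos (Real.rpow_pos_of_pos hp H), ← mul_assoc,
        ← Real.mul_rpow (inv_pos.2 hp).le hp.le, inv_mul_cancel₀ hp.ne', Real.one_rpow, one_mul]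
    have h2 : Tendsto (fun n : ℕ => Gf P (X 0) H (((n + 1 : ℕ) : ℝ)⁻¹)) atTop (𝓝 (Gf P (X 0) H 0)) := by
      refine ((Gf_continuous (hXmeas 0) hH).tendsto 0).comp ?_
      exact (tendsto_inv_atTop_nhds_zero_nat (𝕜 := ℝ)).comp (tendsto_add_atTop_nat 1)
    simp_rw [h1, Gf_zero hH] at h2
    exact tendsto_nhds_unique tendsto_const_nhds h2
  · intro k
    rcases Nat.eq_zero_or_pos k with rfl | hk
    · rfl
    have h := hsi k hk
    have h2 := eqDist_comp h (fun m => (hXmeas _).sub (hXmeas _))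
      (fun m => (hXmeas _).sub (hXmeas _))
      (fun x m => ∑ j ∈ Finset.range m, x j) (by fun_prop)
    unfold EqDistFam
    convert h2.symm using 2
    · ext ω m
      have := Finset.sum_range_sub (fun j => X (j + k) ω) m
      simp only [zero_add] at this
      refine this.symm.trans ?_
      refine Finset.sum_congr rfl fun j _ => ?_
      dsimp only
      rw [show j + 1 + k = j + k + 1 by ring]
    · ext ω m
      exact (Finset.sum_range_sub (fun j => X j ω) m).symm

lemma Disc.incr (hD : Disc P X H) (m m' : ℕ) (c : ℝ) (hc : 0 ≤ c) :
    ∫ ω, min 1 |c ^ H * X m' ω - c ^ H * X m ω| ∂P = Gf P (X 1) H (c * ((m' : ℝ) - m)) := by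
  have hX := hD.meas
  wlog hle : m ≤ m' generalizing m m'
  · have := this m' m (by omega)
    rw [← Gf_neg, show -(c * ((m' : ℝ) - m)) = c * ((m : ℝ) - m') by ring, ← this]
    simp_rw [abs_sub_comm]
  obtain ⟨j, rfl⟩ := Nat.exists_eq_add_of_le' hle
  have h1 := eqDist_integral (hD.si m) (fun m => (hX _).sub (hX _)) (fun m => (hX _).sub (hX _))
    (fun x => min 1 |c ^ H * x j|) (by fun_prop)
  simp only [mul_sub] at h1
  rw [h1]
  have h2 : ∫ ω, min 1 |c ^ H * X j ω - c ^ H * X 0 ω| ∂P = ∫ ω, min 1 |c ^ H * X j ω| ∂P := by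
    refine integral_congr_ae ?_
    filter_upwards [hD.zero] with ω hω
    simp [hω]
  rw [h2]
  push_cast
  rw [show (j : ℝ) + m - m = j by ring]
  rcases Nat.eq_zero_or_pos j with rfl | hj
  · have : ∫ ω, min 1 |c ^ H * X 0 ω| ∂P = ∫ ω, (0 : ℝ) ∂P := by
      refine integral_congr_ae ?_
      filter_upwards [hD.zero] with ω hω
      simp [hω]
    rw [this]
    simp [Gf_zero hD.Hpos]
  · have h3 := eqDist_integral (hD.ss j hj) (fun m => (hX _)) (fun m => (hX _).const_mul _)
      (fun x => min 1 |c ^ H * x 1|) (by fun_prop)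
    simp only [mul_one] at h3
    rw [h3, Gf]
    congr 1
    ext ω
    rw [← mul_assoc, ← Real.mul_rpow hc (Nat.cast_nonneg j), abs_mul,
      abs_of_nonneg (Real.rpow_nonneg (by positivity) H),
      abs_of_nonneg (show 0 ≤ c * (j : ℝ) by positivity)]

end Disc

/-- A continuous-time process compatible with the discrete one on all grids, and stochastically
continuous with the right modulus. -/
structure Good {Ω Ω' : Type*} [MeasurableSpace Ω] [MeasurableSpace Ω'] (P : Measure Ω)
    (X : ℕ → Ω → ℝ) (H : ℝ) (Q : Measure Ω') (Y : NNReal → Ω' → ℝ) : Prop where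
  meas : ∀ t, Measurable (Y t)
  sc : ∀ s t : NNReal, ∫ ω, min 1 |Y t ω - Y s ω| ∂Q = Gf P (X 1) H ((t : ℝ) - s)
  grid : ∀ N : ℕ, 1 ≤ N → EqDistFam Q P (fun (m : ℕ) ω => Y ((m : NNReal) / N) ω)
    (fun m ω => ((N : ℝ)⁻¹) ^ H * X m ω)

/-- Grid approximation of a nonnegative real. -/
def gr (N : ℕ) (t : NNReal) : ℕ := ⌊t * N⌋₊

lemma gr_tendsto (t : NNReal) :
    Tendsto (fun n : ℕ => (gr (n + 1) t : NNReal) / ((n + 1 : ℕ) : NNReal)) atTop (𝓝 t) := by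
  have h := (tendsto_nat_floor_mul_div_atTop (R := ℝ) t.2).comp
    ((tendsto_natCast_atTop_atTop (R := ℝ)).comp (tendsto_add_atTop_nat 1))
  rw [← NNReal.tendsto_coe]
  refine h.congr fun n => ?_
  simp only [Function.comp, gr]
  push_cast
  congr 2

section Good

variable {Ω Ω' : Type*} [MeasurableSpace Ω] [MeasurableSpace Ω'] {P : Measure Ω}
  [IsProbabilityMeasure P] {X : ℕ → Ω → ℝ} {H : ℝ} {Q : Measure Ω'} [IsProbabilityMeasure Q]
  {Y : NNReal → Ω' → ℝ}

lemma tendsto_zero_of_min {u : ℕ → ℝ} (h : Tendsto (fun n => min 1 |u n|) atTop (𝓝 0)) :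
    Tendsto u atTop (𝓝 0) := by
  rw [tendsto_zero_iff_abs_tendsto_zero]
  have h1 : ∀ᶠ n in atTop, min 1 |u n| < 1 := h.eventually (gt_mem_nhds one_pos)
  refine h.congr' ?_
  filter_upwards [h1] with n hn
  rcases min_choice 1 |u n| with h2 | h2
  · rw [h2] at hn; exact absurd hn (lt_irrefl _)
  · exact h2

lemma Good.tendsto (hD : Disc P X H) (hG : Good P X H Q Y) {κ A : Type*} [Fintype κ]
    [TopologicalSpace A] (F : A → (κ → ℝ) → ℝ) (hF : Continuous (Function.uncurry F)) (C : ℝ)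
    (hC : ∀ a x, |F a x| ≤ C) {a : ℕ → A} {a₀ : A} (ha : Tendsto a atTop (𝓝 a₀))
    {t : ℕ → κ → NNReal} {t₀ : κ → NNReal} (ht : ∀ k, Tendsto (fun n => t n k) atTop (𝓝 (t₀ k))) :
    Tendsto (fun n => ∫ ω, F (a n) (fun k => Y (t n k) ω) ∂Q) atTop
      (𝓝 (∫ ω, F a₀ (fun k => Y (t₀ k) ω) ∂Q)) := by
  have hY := hG.meas
  refine tendsto_of_subseq_tendsto fun ns hns => ?_
  set f : ℕ → Ω' → ℝ := fun n ω => ∑ k, min 1 |Y (t (ns n) k) ω - Y (t₀ k) ω| with hf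
  have hfm : ∀ n, Measurable (f n) := fun n => by
    refine Finset.measurable_sum _ fun k _ => ?_
    exact measurable_const.min ((hY _).sub (hY _)).abs
  have hf0 : ∀ n ω, 0 ≤ f n ω := fun n ω =>
    Finset.sum_nonneg fun k _ => le_min zero_le_one (abs_nonneg _)
  have hint : ∀ n k, Integrable (fun ω => min 1 |Y (t (ns n) k) ω - Y (t₀ k) ω|) Q := fun n k =>
    integrable_min_one ((hY _).sub (hY _)).abs fun ω => abs_nonneg _
  have hI : Tendsto (fun n => ∫ ω, f n ω ∂Q) atTop (𝓝 0) := by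
    have h1 : ∀ n, ∫ ω, f n ω ∂Q = ∑ k, Gf P (X 1) H ((t (ns n) k : ℝ) - t₀ k) := by
      intro n
      rw [hf, integral_finsetSum _ fun k _ => hint n k]
      exact Finset.sum_congr rfl fun k _ => hG.sc _ _
    simp_rw [h1]
    rw [← Finset.sum_const_zero (s := (Finset.univ : Finset κ))]
    refine tendsto_finsetSum _ fun k _ => ?_
    rw [← Gf_zero (P := P) (Z := X 1) hD.Hpos]
    refine ((Gf_continuous (hD.meas 1) hD.Hpos).tendsto 0).comp ?_
    have := ((NNReal.tendsto_coe.2 (ht k)).comp hns).sub_const (t₀ k : ℝ)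
    simpa using this
  have hM : TendstoInMeasure Q f atTop (fun _ => 0) := by
    refine tendstoInMeasure_of_tendsto_eLpNorm (p := 1) one_ne_zero
      (fun n => (hfm n).aestronglyMeasurable) aestronglyMeasurable_const ?_
    have h1 : ∀ n, eLpNorm (f n - fun _ => 0) 1 Q = ENNReal.ofReal (∫ ω, f n ω ∂Q) := by
      intro n
      rw [eLpNorm_one_eq_lintegral_enorm,
        ofReal_integral_eq_lintegral_ofReal (integrable_finsetSum _ fun k _ => hint n k)
          (Eventually.of_forall (hf0 n))]
      refine lintegral_congr fun ω => ?_
      change ‖f n ω - 0‖ₑ = ENNReal.ofReal (f n ω)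
      rw [sub_zero, Real.enorm_eq_ofReal (hf0 n ω)]
    simp_rw [h1]
    have := (ENNReal.continuous_ofReal.tendsto 0).comp hI
    rw [ENNReal.ofReal_zero] at this
    exact this
  obtain ⟨ms, hms, hae⟩ := hM.exists_seq_tendsto_ae
  refine ⟨ms, ?_⟩
  refine tendsto_integral_of_dominated_convergence (fun _ => C) ?_ (integrable_const _) ?_ ?_
  · intro n
    have : Continuous (F (a (ns (ms n)))) := hF.comp (by fun_prop : Continuous fun x => (a (ns (ms n)), x))
    exact (this.measurable.comp (measurable_pi_lambda _ fun k => hY _)).aestronglyMeasurable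
  · exact fun n => Eventually.of_forall fun ω => hC _ _
  · filter_upwards [hae] with ω hω
    have h2 : Tendsto (fun n k => Y (t (ns (ms n)) k) ω) atTop (𝓝 fun k => Y (t₀ k) ω) := by
      rw [tendsto_pi_nhds]
      intro k
      rw [← tendsto_sub_nhds_zero_iff]
      apply tendsto_zero_of_min
      refine squeeze_zero (fun n => le_min zero_le_one (abs_nonneg _)) (fun n => ?_) hω
      exact Finset.single_le_sum (f := fun k => min 1 |Y (t (ns (ms n)) k) ω - Y (t₀ k) ω|)
        (fun k _ => le_min zero_le_one (abs_nonneg _)) (Finset.mem_univ k)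
    have h3 : Tendsto (fun n => a (ns (ms n))) atTop (𝓝 a₀) :=
      ha.comp (hns.comp hms.tendsto_atTop)
    exact (hF.tendsto (a₀, fun k => Y (t₀ k) ω)).comp (h3.prodMk_nhds h2)

/-- Uniqueness of finite-dimensional distributions. -/
lemma Good.unique {Ω'' : Type*} [MeasurableSpace Ω''] {Q' : Measure Ω''} [IsProbabilityMeasure Q']
    {Y' : NNReal → Ω'' → ℝ} (hD : Disc P X H) (hG : Good P X H Q Y) (hG' : Good P X H Q' Y')
    {κ : Type*} [Fintype κ] (t : κ → NNReal) :
    Measure.map (fun ω i => Y (t i) ω) Q = Measure.map (fun ω i => Y' (t i) ω) Q' := by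
  refine map_eq_of_integral (X := fun i => Y (t i)) (Y := fun i => Y' (t i))
    (fun i => hG.meas _) (fun i => hG'.meas _) fun f => ?_
  have hc : Continuous (Function.uncurry (fun (_ : Unit) x => f x)) :=
    f.continuous.comp continuous_snd
  have l1 := hG.tendsto hD (fun (_ : Unit) x => f x) hc ‖f‖ (fun _ x => f.norm_coe_le_norm x)
    (a := fun _ => ()) (a₀ := ()) tendsto_const_nhds (fun k => gr_tendsto (t k))
  have l2 := hG'.tendsto hD (fun (_ : Unit) x => f x) hc ‖f‖ (fun _ x => f.norm_coe_le_norm x)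
    (a := fun _ => ()) (a₀ := ()) tendsto_const_nhds (fun k => gr_tendsto (t k))
  refine tendsto_nhds_unique l1 (l2.congr fun n => ?_)
  have e1 := eqDist_integral (hG.grid (n + 1) (by omega)) (fun m => hG.meas _)
    (fun m => (hD.meas _).const_mul _) (fun x => f fun k => x (gr (n + 1) (t k)))
    (f.continuous.measurable.comp (by fun_prop))
  have e2 := eqDist_integral (hG'.grid (n + 1) (by omega)) (fun m => hG'.meas _)
    (fun m => (hD.meas _).const_mul _) (fun x => f fun k => x (gr (n + 1) (t k)))
    (f.continuous.measurable.comp (by fun_prop))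
  exact e2.trans e1.symm

lemma Good.si (hD : Disc P X H) (hG : Good P X H Q Y) (h : NNReal) :
    EqDistFam Q Q (fun t : NNReal => fun ω => Y (t + h) ω - Y h ω)
      (fun t : NNReal => fun ω => Y t ω - Y 0 ω) := by
  have hY := hG.meas
  refine eqDist_of_integral (fun i => (hY _).sub (hY _)) (fun i => (hY _).sub (hY _)) fun I f => ?_
  have hc : Continuous (Function.uncurry (fun (_ : Unit) (x : Option I → ℝ) =>
      f fun k => x (some k) - x none)) :=
    f.continuous.comp (f := fun p : Unit × (Option I → ℝ) => fun k : I => p.2 (some k) - p.2 none) (by fun_prop)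
  have l1 := hG.tendsto hD (fun (_ : Unit) (x : Option I → ℝ) => f fun k => x (some k) - x none)
    hc ‖f‖ (fun _ x => f.norm_coe_le_norm _)
    (a := fun _ => ()) (a₀ := ()) tendsto_const_nhds
    (t := fun n o => ((o.elim 0 (fun k => gr (n + 1) (k : NNReal)) + gr (n + 1) h : ℕ) : NNReal)
      / ((n + 1 : ℕ) : NNReal))
    (t₀ := fun o => o.elim h (fun k => (k : NNReal) + h))
    (by
      rintro (_ | k)
      · simpa using gr_tendsto h
      · have := (gr_tendsto (k : NNReal)).add (gr_tendsto h)
        simp only [Option.elim]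
        refine this.congr fun n => ?_
        push_cast
        rw [add_div])
  have l2 := hG.tendsto hD (fun (_ : Unit) (x : Option I → ℝ) => f fun k => x (some k) - x none)
    hc ‖f‖ (fun _ x => f.norm_coe_le_norm _)
    (a := fun _ => ()) (a₀ := ()) tendsto_const_nhds
    (t := fun n o => ((o.elim 0 (fun k => gr (n + 1) (k : NNReal)) : ℕ) : NNReal)
      / ((n + 1 : ℕ) : NNReal))
    (t₀ := fun o => o.elim 0 (fun k => (k : NNReal)))
    (by
      rintro (_ | k)
      · simp
      · exact gr_tendsto (k : NNReal))
  refine tendsto_nhds_unique l1 (l2.congr fun n => ?_)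
  have e1 := eqDist_integral (hG.grid (n + 1) (by omega)) (fun m => hG.meas _)
    (fun m => (hD.meas _).const_mul _)
    (fun x => f fun k : I => x (gr (n + 1) (k : NNReal) + gr (n + 1) h) - x (0 + gr (n + 1) h))
    (f.continuous.measurable.comp (by fun_prop))
  have e2 := eqDist_integral (hG.grid (n + 1) (by omega)) (fun m => hG.meas _)
    (fun m => (hD.meas _).const_mul _)
    (fun x => f fun k : I => x (gr (n + 1) (k : NNReal)) - x 0)
    (f.continuous.measurable.comp (by fun_prop))
  have e3 := eqDist_integral (hD.si (gr (n + 1) h)) (fun m => (hD.meas _).sub (hD.meas _))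
    (fun m => (hD.meas _).sub (hD.meas _))
    (fun x => f fun k : I => (((n + 1 : ℕ) : ℝ)⁻¹) ^ H * x (gr (n + 1) (k : NNReal)))
    (f.continuous.measurable.comp (by fun_prop))
  simp only [mul_sub] at e3
  refine e2.trans (Eq.trans ?_ e1.symm)
  simp only [zero_add]
  exact e3.symm

lemma Good.ss (hD : Disc P X H) (hG : Good P X H Q Y) (a : NNReal) (ha : 0 < a) :
    EqDistFam Q Q (fun t : NNReal => fun ω => Y (a * t) ω)
      (fun t : NNReal => fun ω => ((a : ℝ) ^ H) * Y t ω) := by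
  have hY := hG.meas
  refine eqDist_of_integral (fun i => hY _) (fun i => (hY _).const_mul _) fun I f => ?_
  have hc : Continuous (Function.uncurry (fun (b : NNReal) (x : I → ℝ) =>
      f fun k => (b : ℝ) ^ H * x k)) := by
    refine f.continuous.comp (f := fun p : NNReal × (I → ℝ) => fun k : I => (p.1 : ℝ) ^ H * p.2 k) ?_
    refine continuous_pi fun k => Continuous.mul ?_ (by fun_prop)
    exact Continuous.rpow_const (by fun_prop) fun x => Or.inr hD.Hpos.le
  have hc1 : Continuous (Function.uncurry (fun (_ : Unit) x => f x)) :=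
    f.continuous.comp continuous_snd
  have l1 := hG.tendsto hD (fun (_ : Unit) x => f x) hc1 ‖f‖ (fun _ x => f.norm_coe_le_norm x)
    (a := fun _ => ()) (a₀ := ()) tendsto_const_nhds
    (t := fun n (k : I) => ((gr (n + 1) a * gr (n + 1) (k : NNReal) : ℕ) : NNReal)
      / (((n + 1) * (n + 1) : ℕ) : NNReal))
    (t₀ := fun k => a * k)
    (fun k => by
      refine ((gr_tendsto a).mul (gr_tendsto (k : NNReal))).congr fun n => ?_
      push_cast
      rw [div_mul_div_comm])
  have l2 := hG.tendsto hD (fun (b : NNReal) (x : I → ℝ) => f fun k => (b : ℝ) ^ H * x k) hc ‖f‖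
    (fun _ x => f.norm_coe_le_norm _) (gr_tendsto a) (fun k : I => gr_tendsto (k : NNReal))
  refine tendsto_nhds_unique l1 (l2.congr' ?_)
  have hpos : ∀ᶠ n in atTop, 0 < (gr (n + 1) a : NNReal) / ((n + 1 : ℕ) : NNReal) :=
    (gr_tendsto a).eventually (lt_mem_nhds ha)
  filter_upwards [hpos] with n hn
  have hp : 1 ≤ gr (n + 1) a := by
    rcases Nat.eq_zero_or_pos (gr (n + 1) a) with h0 | h0
    · simp [h0] at hn
    · exact h0
  have e1 := eqDist_integral (hG.grid ((n + 1) * (n + 1)) (by nlinarith)) (fun m => hG.meas _)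
    (fun m => (hD.meas _).const_mul _)
    (fun x => f fun k : I => x (gr (n + 1) a * gr (n + 1) (k : NNReal)))
    (f.continuous.measurable.comp (by fun_prop))
  have e2 := eqDist_integral (hG.grid (n + 1) (by omega)) (fun m => hG.meas _)
    (fun m => (hD.meas _).const_mul _)
    (fun x => f fun k : I => (((gr (n + 1) a : NNReal) / ((n + 1 : ℕ) : NNReal) : NNReal) : ℝ) ^ H
      * x (gr (n + 1) (k : NNReal)))
    (f.continuous.measurable.comp (by fun_prop))
  have e3 := eqDist_integral (hD.ss (gr (n + 1) a) hp) (fun m => (hD.meas _))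
    (fun m => (hD.meas _).const_mul _)
    (fun x => f fun k : I => (((((n + 1) * (n + 1) : ℕ) : ℝ))⁻¹) ^ H * x (gr (n + 1) (k : NNReal)))
    (f.continuous.measurable.comp (by fun_prop))
  refine e2.trans (Eq.trans ?_ e1.symm)
  refine Eq.trans ?_ e3.symm
  congr 1
  ext ω
  congr 1
  ext k
  rw [← mul_assoc, ← mul_assoc]
  congr 1
  push_cast
  rw [← Real.mul_rpow (by positivity) (by positivity), ← Real.mul_rpow (by positivity) (by positivity)]
  congr 1
  field_simp

/-- A process satisfying the three properties is good. -/
lemma good_of (hD : Disc P X H) (hY : ∀ t, Measurable (Y t))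
    (hss : ∀ a : NNReal, 0 < a →
          EqDistFam Q Q (fun t : NNReal => fun ω => Y (a * t) ω)
            (fun t : NNReal => fun ω => ((a : ℝ) ^ H) * Y t ω))
    (hsi : ∀ h : NNReal,
          EqDistFam Q Q (fun t : NNReal => fun ω => Y (t + h) ω - Y h ω)
            (fun t : NNReal => fun ω => Y t ω - Y 0 ω))
    (hX : EqDistFam Q P (fun n : ℕ => fun ω => Y (n : NNReal) ω) X) : Good P X H Q Y := by
  have hXm := hD.meas
  have hz : ∀ᵐ ω ∂Q, Y 0 ω = 0 := by
    apply ae_zero_of_min (hY 0)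
    have := eqDist_integral hX (fun m => hY _) hXm (fun x => min 1 |x 0|) (by fun_prop)
    simp only [Nat.cast_zero] at this
    rw [this]
    have : ∫ ω, min 1 |X 0 ω| ∂P = ∫ ω, (0 : ℝ) ∂P := by
      refine integral_congr_ae ?_
      filter_upwards [hD.zero] with ω hω
      simp [hω]
    simp [this]
  refine ⟨hY, ?_, ?_⟩
  · intro s t
    wlog hst : s ≤ t generalizing s t
    · have := this t s (le_of_not_ge hst)
      rw [← Gf_neg, neg_sub, ← this]
      simp_rw [abs_sub_comm]
    obtain ⟨u, rfl⟩ := exists_add_of_le hst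
    have h1 := eqDist_integral (hsi s) (fun m => (hY _).sub (hY _)) (fun m => (hY _).sub (hY _))
      (fun x => min 1 |x u|) (by fun_prop)
    simp only [] at h1
    rw [add_comm s u, h1]
    have h2 : ∫ ω, min 1 |Y u ω - Y 0 ω| ∂Q = ∫ ω, min 1 |Y u ω| ∂Q := by
      refine integral_congr_ae ?_
      filter_upwards [hz] with ω hω
      simp [hω]
    rw [h2]
    push_cast
    rw [add_sub_cancel_right]
    rcases eq_or_lt_of_le (zero_le : 0 ≤ u) with rfl | hu
    · have : ∫ ω, min 1 |Y 0 ω| ∂Q = ∫ ω, (0 : ℝ) ∂Q := by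
        refine integral_congr_ae ?_
        filter_upwards [hz] with ω hω
        simp [hω]
      rw [this]
      simp [Gf_zero hD.Hpos]
    · have h3 := eqDist_integral (hss u hu) (fun m => hY _) (fun m => (hY _).const_mul _)
        (fun x => min 1 |x 1|) (by fun_prop)
      have h4 := eqDist_integral hX (fun m => hY _) hXm (fun x => min 1 |(u : ℝ) ^ H * x 1|)
        (by fun_prop)
      simp only [mul_one, Nat.cast_one] at h3 h4
      rw [h3, h4, Gf]
      simp_rw [abs_mul]
      rw [abs_of_nonneg (Real.rpow_nonneg (NNReal.coe_nonneg u) H), abs_of_nonneg (NNReal.coe_nonneg u)]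
  · intro N hN
    have hN' : (0 : NNReal) < (N : NNReal)⁻¹ := by positivity
    have h1 := eqDist_comp (hss _ hN') (fun m => hY _) (fun m => (hY _).const_mul _)
      (fun x (m : ℕ) => x (m : NNReal)) (by fun_prop)
    have h2 := eqDist_comp hX (fun m => hY _) hXm (fun x m => ((N : ℝ)⁻¹) ^ H * x m) (by fun_prop)
    have h3 : Measure.map (fun ω (m : ℕ) => Y ((m : NNReal) / N) ω) Q
       = Measure.map (fun ω (m : ℕ) => Y ((N : NNReal)⁻¹ * m) ω) Q := by
      simp_rw [div_eq_inv_mul]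
    refine h3.trans (h1.trans (Eq.trans ?_ h2))
    simp

end Good

section Construct

variable {Ω : Type*} [MeasurableSpace Ω] {P : Measure Ω} [IsProbabilityMeasure P]
  {X : ℕ → Ω → ℝ} {H : ℝ}

lemma exists_D (hD : Disc P X H) : ∃ D : ℕ → ℕ, (∀ n, 0 < D n) ∧ (∀ n k, n ≤ k → D n ∣ D k) ∧
    (∀ N, 1 ≤ N → ∃ n, N ∣ D n) ∧ (∀ n, Gf P (X 1) H ((D n : ℝ)⁻¹) ≤ (1 / 2) ^ n) ∧
    Tendsto D atTop atTop := by
  have h1 : Tendsto (fun k : ℕ => Gf P (X 1) H (((k.factorial : ℕ) : ℝ)⁻¹)) atTop (𝓝 0) := by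
    rw [← Gf_zero (P := P) (Z := X 1) hD.Hpos]
    refine ((Gf_continuous (hD.meas 1) hD.Hpos).tendsto 0).comp ?_
    exact (tendsto_inv_atTop_nhds_zero_nat (𝕜 := ℝ)).comp
      (tendsto_atTop_mono Nat.self_le_factorial tendsto_id)
  obtain ⟨φ, hφ, hφ2⟩ := extraction_forall_of_eventually
    (P := fun n k => Gf P (X 1) H (((k.factorial : ℕ) : ℝ)⁻¹) ≤ (1 / 2) ^ n)
    (fun n => h1.eventually (ge_mem_nhds (by positivity)))
  refine ⟨fun n => (φ n).factorial, fun n => Nat.factorial_pos _, ?_, ?_, hφ2, ?_⟩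
  · exact fun n k h => Nat.factorial_dvd_factorial (hφ.monotone h)
  · exact fun N hN => ⟨N, Nat.dvd_factorial hN (hφ.le_apply)⟩
  · exact tendsto_atTop_mono (fun n => hφ.le_apply.trans (Nat.self_le_factorial _)) tendsto_id

lemma scale (hD : Disc P X H) {d M : ℕ} (hM : 0 < M) (hd : d ∣ M) :
    Measure.map (fun ω (m : ℕ) => ((M : ℝ)⁻¹) ^ H * X (M / d * m) ω) P
      = Measure.map (fun ω (m : ℕ) => ((d : ℝ)⁻¹) ^ H * X m ω) P := by
  obtain ⟨r, rfl⟩ := hd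
  have hd0 : 0 < d := Nat.pos_of_mul_pos_right hM
  have hr0 : 0 < r := Nat.pos_of_mul_pos_left hM
  rw [Nat.mul_div_cancel_left _ hd0]
  refine (eqDist_comp (hD.ss r hr0) (fun m => hD.meas _) (fun m => (hD.meas _).const_mul _)
    (fun x m => (((d * r : ℕ) : ℝ)⁻¹) ^ H * x m) (by fun_prop)).trans ?_
  congr 1
  ext ω m
  rw [← mul_assoc]
  congr 1
  push_cast
  rw [← Real.mul_rpow (by positivity) (by positivity)]
  congr 1
  field_simp

lemma exists_mu (hD : Disc P X H) (D : ℕ → ℕ) (hpos : ∀ n, 0 < D n)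
    (hdvd : ∀ n k, n ≤ k → D n ∣ D k) :
    ∃ μ : Measure (ℕ × ℕ → ℝ), IsProbabilityMeasure μ ∧
      (∀ n, Measure.map (fun (w : ℕ × ℕ → ℝ) (m : ℕ) => w (n, m)) μ
        = Measure.map (fun ω (m : ℕ) => ((D n : ℝ)⁻¹) ^ H * X m ω) P) ∧
      ∀ n k m, n ≤ k → ∀ᵐ w ∂μ, w (k, D k / D n * m) = w (n, m) := by
  have hX := hD.meas
  set V : ℕ → Ω → (ℕ × ℕ → ℝ) := fun N ω p =>
    if p.1 ≤ N then ((D N : ℝ)⁻¹) ^ H * X (D N / D p.1 * p.2) ω else 0 with hV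
  have hVm : ∀ N, Measurable (V N) := by
    intro N
    refine measurable_pi_lambda _ fun p => ?_
    by_cases hp : p.1 ≤ N
    · simp only [hV, hp, if_true]; exact (hX _).const_mul _
    · simp only [hV, hp, if_false]; exact measurable_const
  set ν : ℕ → ProbabilityMeasure (ℕ × ℕ → ℝ) := fun N =>
    ⟨Measure.map (V N) P, Measure.isProbabilityMeasure_map (hVm N).aemeasurable⟩ with hν
  have hlaw : ∀ n N, n ≤ N → Measure.map (fun ω (m : ℕ) => V N ω (n, m)) P
      = Measure.map (fun ω (m : ℕ) => ((D n : ℝ)⁻¹) ^ H * X m ω) P := by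
    intro n N h
    rw [← scale hD (hpos N) (hdvd n N h)]
    simp only [hV, h, if_true]
  have htight : IsTightMeasureSet
      {((μ : ProbabilityMeasure (ℕ × ℕ → ℝ)) : Measure (ℕ × ℕ → ℝ)) | μ ∈ Set.range ν} := by
    rw [isTightMeasureSet_iff_exists_isCompact_measure_compl_le]
    intro ε hε
    obtain ⟨δ, hδ, hδs⟩ := ENNReal.exists_pos_sum_of_countable' hε.ne' (ℕ × ℕ)
    have hK : ∀ p : ℕ × ℕ, ∃ K : Set ℝ, IsCompact K ∧
        (Measure.map (fun ω => ((D p.1 : ℝ)⁻¹) ^ H * X p.2 ω) P) Kᶜ ≤ δ p := by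
      intro p
      have := Measure.isProbabilityMeasure_map (μ := P)
        ((hX p.2).const_mul (((D p.1 : ℝ)⁻¹) ^ H)).aemeasurable
      obtain ⟨K, hK, h⟩ := isTightMeasureSet_iff_exists_isCompact_measure_compl_le.1
        (isTightMeasureSet_singleton
          (μ := Measure.map (fun ω => ((D p.1 : ℝ)⁻¹) ^ H * X p.2 ω) P)) (δ p) (hδ p)
      exact ⟨K, hK, h _ rfl⟩
    choose K hKc hKm using hK
    refine ⟨Set.univ.pi fun p => K p ∪ {0},
      isCompact_univ_pi fun p => (hKc p).union isCompact_singleton, ?_⟩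
    rintro _ ⟨_, ⟨N, rfl⟩, rfl⟩
    have hmeas : ∀ p, MeasurableSet (K p ∪ {0}) := fun p =>
      ((hKc p).union isCompact_singleton).measurableSet
    have hsub : (Set.univ.pi fun p => K p ∪ {0})ᶜ
        ⊆ ⋃ p : ℕ × ℕ, (fun w : ℕ × ℕ → ℝ => w p) ⁻¹' (K p ∪ {0})ᶜ := by
      intro w hw
      simp only [Set.mem_compl_iff, Set.mem_univ_pi, not_forall] at hw
      obtain ⟨p, hp⟩ := hw
      exact Set.mem_iUnion.2 ⟨p, hp⟩
    refine (measure_mono hsub).trans ((measure_iUnion_le _).trans (le_trans ?_ hδs.le))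
    refine ENNReal.tsum_le_tsum fun p => ?_
    change (Measure.map (V N) P) _ ≤ _
    rw [Measure.map_apply (hVm N) ((measurable_pi_apply p) (hmeas p).compl)]
    by_cases hp : p.1 ≤ N
    · have h1 := congrArg (fun ρ => ρ ((fun x : ℕ → ℝ => x p.2) ⁻¹' (K p)ᶜ)) (hlaw p.1 N hp)
      have hKm' : MeasurableSet ((fun x : ℕ → ℝ => x p.2) ⁻¹' (K p)ᶜ) :=
        (measurable_pi_apply p.2) (hKc p).measurableSet.compl
      have hVm' : Measurable (fun ω (m : ℕ) => V N ω (p.1, m)) := measurable_pi_lambda _ fun m =>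
        (measurable_pi_apply (p.1, m)).comp (hVm N)
      rw [Measure.map_apply hVm' hKm',
        Measure.map_apply (measurable_pi_lambda _ fun m => (hX m).const_mul _) hKm'] at h1
      have h2 := hKm p
      rw [Measure.map_apply ((hX _).const_mul _) (hKc p).measurableSet.compl] at h2
      refine le_trans (measure_mono ?_) (h1.le.trans h2)
      intro ω hω
      simp only [Set.mem_preimage, Set.mem_compl_iff, Set.mem_union, not_or] at hω ⊢
      exact hω.1
    · have : (V N ⁻¹' ((fun w : ℕ × ℕ → ℝ => w p) ⁻¹' (K p ∪ {0})ᶜ)) = ∅ := by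
        ext ω
        simp [hV, hp]
      rw [this]
      simp
  have hcomp := isCompact_closure_of_isTightMeasureSet htight
  obtain ⟨μ, -, hμ⟩ := hcomp.exists_mapClusterPt (f := atTop) (u := ν)
    (tendsto_principal.2 (Eventually.of_forall fun n => subset_closure (Set.mem_range_self n)))
  have clus : ∀ {F : Type} [MeasurableSpace F] [TopologicalSpace F] [BorelSpace F]
      [HasOuterApproxClosed F] (g : (ℕ × ℕ → ℝ) → F) (hg : Continuous g) (ρ : Measure F)
      (_ : ∀ᶠ N in atTop, Measure.map (fun ω => g (V N ω)) P = ρ),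
      Measure.map g (μ : Measure (ℕ × ℕ → ℝ)) = ρ := by
    intro F _ _ _ _ g hg ρ hρ
    have h1 := hμ.continuousAt_comp (ProbabilityMeasure.continuous_map hg).continuousAt
    obtain ⟨N0, hN0⟩ := hρ.exists
    have hprob : IsProbabilityMeasure ρ := by
      rw [← hN0]
      exact Measure.isProbabilityMeasure_map (hg.measurable.comp (hVm N0)).aemeasurable
    have h2 : Tendsto ((fun ν' => ProbabilityMeasure.map ν' hg.measurable.aemeasurable) ∘ ν) atTop
        (𝓝 (⟨ρ, hprob⟩ : ProbabilityMeasure F)) := by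
      refine tendsto_const_nhds.congr' ?_
      filter_upwards [hρ] with N hN
      apply Subtype.ext
      change ρ = Measure.map g (Measure.map (V N) P)
      rw [Measure.map_map hg.measurable (hVm N)]
      exact hN.symm
    have h3 := eq_of_nhds_neBot (x := ProbabilityMeasure.map μ hg.measurable.aemeasurable)
      (y := (⟨ρ, hprob⟩ : ProbabilityMeasure F)) (ClusterPt.mono h1 h2).neBot
    exact congrArg Subtype.val h3
  refine ⟨μ, inferInstance, ?_, ?_⟩
  · intro n
    refine clus (fun w m => w (n, m)) (by fun_prop) _ ?_
    filter_upwards [eventually_ge_atTop n] with N hN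
    exact hlaw n N hN
  · intro n k m hnk
    have h1 := clus (fun w => w (k, D k / D n * m) - w (n, m)) (by fun_prop) (Measure.dirac 0) (by
      filter_upwards [eventually_ge_atTop k] with N hN
      have : ∀ ω, V N ω (k, D k / D n * m) - V N ω (n, m) = 0 := by
        intro ω
        simp only [hV, hN, hnk.trans hN, if_true]
        rw [← mul_assoc, Nat.div_mul_div_comm (hdvd k N hN) (hdvd n k hnk), mul_comm (D N) (D k),
          Nat.mul_div_mul_left _ _ (hpos k), sub_self]
      simp only [this, Measure.map_const, measure_univ, one_smul])
    have h2 : ∀ᵐ x ∂(Measure.map (fun w : ℕ × ℕ → ℝ => w (k, D k / D n * m) - w (n, m))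
        (μ : Measure (ℕ × ℕ → ℝ))), x = 0 := by
      rw [h1, ae_dirac_eq]
      rfl
    have h3 := ae_of_ae_map (Continuous.aemeasurable (by fun_prop)) h2
    filter_upwards [h3] with w hw
    linarith

lemma gr_bounds (N : ℕ) (hN : 0 < N) (t : NNReal) :
    (gr N t : ℝ) / N ≤ t ∧ (t : ℝ) - 1 / N < (gr N t : ℝ) / N := by
  have hN' : (0 : ℝ) < N := by exact_mod_cast hN
  have h1 : (gr N t : ℝ) ≤ t * N := by
    have := Nat.floor_le (a := t * N) zero_le
    exact_mod_cast this
  have h2 : (t : ℝ) * N < gr N t + 1 := by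
    have := Nat.lt_floor_add_one (t * N)
    exact_mod_cast this
  constructor
  · rwa [div_le_iff₀ hN']
  · rw [lt_div_iff₀ hN', sub_mul, one_div, inv_mul_cancel₀ hN'.ne']
    linarith

lemma summable_of_min {u : ℕ → ℝ} (h : Summable fun n => min 1 |u n|) : Summable fun n => |u n| := by
  have h1 : ∀ᶠ n in atTop, min 1 |u n| < 1 := h.tendsto_atTop_zero.eventually (gt_mem_nhds one_pos)
  refine (summable_congr_atTop ?_).1 h
  filter_upwards [h1] with n hn
  rcases min_choice 1 |u n| with h2 | h2
  · rw [h2] at hn; exact absurd hn (lt_irrefl _)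
  · exact h2

lemma exists_good (hD : Disc P X H) : ∃ (Q : Measure (ℕ × ℕ → ℝ)) (Y : NNReal → (ℕ × ℕ → ℝ) → ℝ),
    IsProbabilityMeasure Q ∧ Good P X H Q Y := by
  obtain ⟨D, hpos, hdvd, hdiv, hGf, hDtop⟩ := exists_D hD
  obtain ⟨μ, hμ, hlaw, hcomp⟩ := exists_mu hD D hpos hdvd
  have hX := hD.meas
  have hpos' : ∀ n, (0 : ℝ) < D n := fun n => by exact_mod_cast hpos n
  have lev : ∀ n m m', ∫ w : ℕ × ℕ → ℝ, min 1 |w (n, m') - w (n, m)| ∂μ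
      = Gf P (X 1) H ((m' : ℝ) / D n - m / D n) := by
    intro n m m'
    have h1 := eqDist_integral (P₁ := μ) (P₂ := P)
      (X := fun m (w : ℕ × ℕ → ℝ) => w (n, m)) (Y := fun m ω => ((D n : ℝ)⁻¹) ^ H * X m ω)
      (hlaw n) (fun m => measurable_pi_apply _)
      (fun m => (hX m).const_mul _) (fun x => min 1 |x m' - x m|) (by fun_prop)
    rw [h1, hD.incr m m' _ (inv_pos.2 (hpos' n)).le]
    congr 1
    ring
  have step : ∀ t n, ∫ w : ℕ × ℕ → ℝ, min 1 |w (n + 1, gr (D (n + 1)) t) - w (n, gr (D n) t)| ∂μ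
      ≤ (1 / 2) ^ n := by
    intro t n
    have h1 : ∫ w : ℕ × ℕ → ℝ, min 1 |w (n + 1, gr (D (n + 1)) t) - w (n, gr (D n) t)| ∂μ
        = ∫ w : ℕ × ℕ → ℝ, min 1 |w (n + 1, gr (D (n + 1)) t)
          - w (n + 1, D (n + 1) / D n * gr (D n) t)| ∂μ := by
      refine integral_congr_ae ?_
      filter_upwards [hcomp n (n + 1) (gr (D n) t) (by omega)] with w hw
      rw [hw]
    rw [h1, lev]
    refine le_trans (Gf_mono (hX 1) hD.Hpos ?_) (hGf n)
    have h2 : ((D (n + 1) / D n * gr (D n) t : ℕ) : ℝ) / D (n + 1) = (gr (D n) t : ℝ) / D n := by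
      rw [Nat.cast_mul, Nat.cast_div (hdvd n (n + 1) (by omega)) (hpos' n).ne']
      have := (hpos' n).ne'
      have := (hpos' (n + 1)).ne'
      field_simp
    rw [h2, abs_of_pos (inv_pos.2 (hpos' n)), ← one_div, abs_le]
    have b1 := gr_bounds (D n) (hpos n) t
    have b2 := gr_bounds (D (n + 1)) (hpos (n + 1)) t
    have b3 : 1 / (D (n + 1) : ℝ) ≤ 1 / D n := by
      apply one_div_le_one_div_of_le (hpos' n)
      exact_mod_cast Nat.le_of_dvd (hpos (n + 1)) (hdvd n (n + 1) (by omega))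
    constructor <;> linarith [b1.1, b1.2, b2.1, b2.2]
  have hconv : ∀ t, ∀ᵐ w ∂μ, ∃ l : ℝ,
      Tendsto (fun n => (w : ℕ × ℕ → ℝ) (n, gr (D n) t)) atTop (𝓝 l) := by
    intro t
    set g : ℕ → (ℕ × ℕ → ℝ) → ℝ := fun n w =>
      min 1 |w (n + 1, gr (D (n + 1)) t) - w (n, gr (D n) t)| with hg
    have hgm : ∀ n, Measurable (g n) := fun n => by simp only [hg]; fun_prop
    have hg0 : ∀ n w, 0 ≤ g n w := fun n w => le_min zero_le_one (abs_nonneg _)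
    have hgi : ∀ n, Integrable (g n) μ := fun n =>
      integrable_min_one (by fun_prop) fun w => abs_nonneg _
    have h1 : ∫⁻ w, ∑' n, ENNReal.ofReal (g n w) ∂μ ≠ ⊤ := by
      rw [lintegral_tsum fun n => (hgm n).ennreal_ofReal.aemeasurable]
      have h2 : ∀ n, ∫⁻ w, ENNReal.ofReal (g n w) ∂μ ≤ ENNReal.ofReal ((1 / 2) ^ n) := by
        intro n
        rw [← ofReal_integral_eq_lintegral_ofReal (hgi n) (Eventually.of_forall (hg0 n))]
        exact ENNReal.ofReal_le_ofReal (step t n)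
      refine ne_top_of_le_ne_top ?_ (ENNReal.tsum_le_tsum h2)
      rw [← ENNReal.ofReal_tsum_of_nonneg (fun n => by positivity) summable_geometric_two]
      exact ENNReal.ofReal_ne_top
    have h3 := ae_lt_top (Measurable.tsum fun n => (hgm n).ennreal_ofReal) h1
    filter_upwards [h3] with w hw
    have h4 := ENNReal.summable_toReal hw.ne
    simp only [ENNReal.toReal_ofReal (hg0 _ w)] at h4
    have h5 := summable_of_min h4
    refine cauchySeq_tendsto_of_complete (cauchySeq_of_summable_dist ?_)
    refine h5.congr fun n => ?_
    rw [dist_comm, Real.dist_eq]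
  have hlim : ∀ t : NNReal, ∃ y : (ℕ × ℕ → ℝ) → ℝ, Measurable y ∧
      ∀ᵐ w ∂μ, Tendsto (fun n => w (n, gr (D n) t)) atTop (𝓝 (y w)) := fun t =>
    measurable_limit_of_tendsto_metrizable_ae (f := fun n (w : ℕ × ℕ → ℝ) => w (n, gr (D n) t))
      (fun n => (measurable_pi_apply _).aemeasurable) (hconv t)
  choose Y hYm hYl using hlim
  have hgt : ∀ t : NNReal, Tendsto (fun n => (gr (D n) t : ℝ) / D n) atTop (𝓝 (t : ℝ)) := by
    intro t
    have h := (tendsto_nat_floor_mul_div_atTop (R := ℝ) t.2).comp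
      ((tendsto_natCast_atTop_atTop (R := ℝ)).comp hDtop)
    refine h.congr fun n => ?_
    simp only [Function.comp, gr]
    congr 2
  refine ⟨μ, Y, hμ, hYm, ?_, ?_⟩
  · intro s t
    have l1 : Tendsto (fun n => ∫ w : ℕ × ℕ → ℝ, min 1 |w (n, gr (D n) t) - w (n, gr (D n) s)| ∂μ)
        atTop (𝓝 (∫ w, min 1 |Y t w - Y s w| ∂μ)) := by
      refine tendsto_integral_of_dominated_convergence (fun _ => 1) ?_ (integrable_const _) ?_ ?_
      · exact fun n => Measurable.aestronglyMeasurable (by fun_prop)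
      · exact fun n => Eventually.of_forall fun w => norm_min_one_le (abs_nonneg _)
      · filter_upwards [hYl t, hYl s] with w h1 h2
        exact tendsto_const_nhds.min (h1.sub h2).abs
    simp_rw [lev] at l1
    refine tendsto_nhds_unique l1 ?_
    exact ((Gf_continuous (hX 1) hD.Hpos).tendsto _).comp ((hgt t).sub (hgt s))
  · intro N hN
    obtain ⟨n, hn⟩ := hdiv N hN
    have hae : ∀ᵐ w ∂μ, ∀ m : ℕ, Y ((m : NNReal) / N) w = w (n, D n / N * m) := by
      rw [ae_all_iff]
      intro m
      have h1 : ∀ᵐ w ∂μ, ∀ k, n ≤ k → w (k, D k / D n * (D n / N * m)) = w (n, D n / N * m) := by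
        rw [ae_all_iff]
        intro k
        by_cases hk : n ≤ k
        · filter_upwards [hcomp n k (D n / N * m) hk] with w hw _ using hw
        · exact Eventually.of_forall fun w h => absurd h hk
      filter_upwards [h1, hYl ((m : NNReal) / N)] with w hw hl
      refine tendsto_nhds_unique hl (tendsto_const_nhds.congr' ?_)
      filter_upwards [eventually_ge_atTop n] with k hk
      rw [← hw k hk]
      congr 2
      obtain ⟨r, hr⟩ := hn
      obtain ⟨q, hq⟩ := hdvd n k hk
      have hr0 : D k / D n = q := by rw [hq, Nat.mul_div_cancel_left _ (hpos n)]
      have hr1 : D n / N = r := by rw [hr, Nat.mul_div_cancel_left _ hN]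
      rw [hr0, hr1, gr, hq, hr]
      have hNN : (N : NNReal) ≠ 0 := by positivity
      have : (m : NNReal) / N * ((N * r * q : ℕ) : NNReal) = ((q * (r * m) : ℕ) : NNReal) := by
        push_cast
        field_simp
      rw [this, Nat.floor_natCast]
    have e1 : Measure.map (fun w (m : ℕ) => Y ((m : NNReal) / N) w) μ
        = Measure.map (fun (w : ℕ × ℕ → ℝ) (m : ℕ) => w (n, D n / N * m)) μ := by
      refine Measure.map_congr ?_
      filter_upwards [hae] with w hw
      ext m
      exact hw m
    have e2 := eqDist_comp (P₁ := μ) (P₂ := P)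
      (X := fun m (w : ℕ × ℕ → ℝ) => w (n, m)) (Y := fun m ω => ((D n : ℝ)⁻¹) ^ H * X m ω)
      (hlaw n) (fun m => measurable_pi_apply _)
      (fun m => (hX m).const_mul _) (fun x (m : ℕ) => x (D n / N * m)) (by fun_prop)
    exact e1.trans (e2.trans (scale hD (hpos n) hn))

end Construct

end DtSs

/-- Theorem 2.2 (embedding): a dt-ss-si process with scaling function `n ^ H`, `H > 0`,
extends to a continuous-time ss-si process, uniquely in the sense of finite-dimensional
distributions. -/
theorem stmt7 {Ω : Type*} [MeasurableSpace Ω] (P : Measure Ω) [IsProbabilityMeasure P]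
    (X : ℕ → Ω → ℝ) (hXmeas : ∀ n, Measurable (X n))
    (H : ℝ) (hH : 0 < H)
    (hss : SelfSimilar P X (fun n => (n : ℝ) ^ H))
    (hsi : StationaryIncrements P X) :
    (∃ (Ω' : Type) (_ : MeasurableSpace Ω') (P' : Measure Ω'),
      IsProbabilityMeasure P' ∧
      ∃ Y : NNReal → Ω' → ℝ, (∀ t, Measurable (Y t)) ∧
        (∀ a : NNReal, 0 < a →
          EqDistFam P' P' (fun t : NNReal => fun ω => Y (a * t) ω)
            (fun t : NNReal => fun ω => ((a : ℝ) ^ H) * Y t ω)) ∧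
        (∀ h : NNReal,
          EqDistFam P' P' (fun t : NNReal => fun ω => Y (t + h) ω - Y h ω)
            (fun t : NNReal => fun ω => Y t ω - Y 0 ω)) ∧
        EqDistFam P' P (fun n : ℕ => fun ω => Y (n : NNReal) ω) X) ∧
    (∀ (Ω₁ : Type) (_ : MeasurableSpace Ω₁) (P₁ : Measure Ω₁),
      IsProbabilityMeasure P₁ →
      ∀ (Ω₂ : Type) (_ : MeasurableSpace Ω₂) (P₂ : Measure Ω₂),
      IsProbabilityMeasure P₂ →
      ∀ (Y₁ : NNReal → Ω₁ → ℝ) (Y₂ : NNReal → Ω₂ → ℝ),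
      (∀ t, Measurable (Y₁ t)) → (∀ t, Measurable (Y₂ t)) →
      (∀ a : NNReal, 0 < a →
        EqDistFam P₁ P₁ (fun t : NNReal => fun ω => Y₁ (a * t) ω)
          (fun t : NNReal => fun ω => ((a : ℝ) ^ H) * Y₁ t ω)) →
      (∀ h : NNReal,
        EqDistFam P₁ P₁ (fun t : NNReal => fun ω => Y₁ (t + h) ω - Y₁ h ω)
          (fun t : NNReal => fun ω => Y₁ t ω - Y₁ 0 ω)) →
      EqDistFam P₁ P (fun n : ℕ => fun ω => Y₁ (n : NNReal) ω) X →
      (∀ a : NNReal, 0 < a →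
        EqDistFam P₂ P₂ (fun t : NNReal => fun ω => Y₂ (a * t) ω)
          (fun t : NNReal => fun ω => ((a : ℝ) ^ H) * Y₂ t ω)) →
      (∀ h : NNReal,
        EqDistFam P₂ P₂ (fun t : NNReal => fun ω => Y₂ (t + h) ω - Y₂ h ω)
          (fun t : NNReal => fun ω => Y₂ t ω - Y₂ 0 ω)) →
      EqDistFam P₂ P (fun n : ℕ => fun ω => Y₂ (n : NNReal) ω) X →
      ∀ (k : ℕ) (t : Fin k → NNReal),
        Measure.map (fun ω i => Y₁ (t i) ω) P₁ =
          Measure.map (fun ω i => Y₂ (t i) ω) P₂) := by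
  have hD : DtSs.Disc P X H := DtSs.disc_of hXmeas hH hss hsi
  refine ⟨?_, ?_⟩
  · obtain ⟨Q, Y, hQ, hG⟩ := DtSs.exists_good hD
    refine ⟨ℕ × ℕ → ℝ, inferInstance, Q, hQ, Y, hG.meas, fun a ha => hG.ss hD a ha,
      fun h => hG.si hD h, ?_⟩
    have := hG.grid 1 le_rfl
    simpa using this
  · intro Ω₁ _ P₁ h1 Ω₂ _ P₂ h2 Y₁ Y₂ m1 m2 a1 b1 c1 a2 b2 c2 k t
    exact (DtSs.good_of hD m1 a1 b1 c1).unique hD (DtSs.good_of hD m2 a2 b2 c2) t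
end
end
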